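/- arXiv:1505.03012 — 2 statements merged into one kernel-verified Lean document; each statement's English description precedes it below -/
import Mathlib

section
/- Let p₁,…,p_m be distinct points in ℝ² and γ₁,…,γ_m real numbers with γⱼ > −1 for each j. Let u solve Δu + 2e^u = 4π Σⱼ γⱼ δ_{pⱼ} in the classical sense (u is C² on ℝ² ∖ {p₁,…,p_m}, Δu + 2e^u = 0 there, and for each j the function x ↦ u(x) − 2γⱼ log|x−pⱼ| is bounded near pⱼ), with ∫_{ℝ²} e^u < ∞. Then there exist real numbers α > 2, c, and σ > 0 such that for all |y| > max(1, 2 maxⱼ |pⱼ|): u(y) = −α log|y| + c + O(|y|^{−σ}) and ∇u(y) = −α y/|y|² + O(|y|^{−σ−1}); that is, |u(y) + α log|y| − c| ≤ C|y|^{−σ} and |∇u(y) + α y/|y|²| ≤ C|y|^{−σ−1} for some constant C. -/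
noncomputable section
open Real MeasureTheory Metric Filter Topology

/-- The plane `ℝ²` with the Euclidean metric. -/
abbrev E2 := EuclideanSpace ℝ (Fin 2)

/-- The Euclidean Laplacian on `ℝ²`: `Δu = ∂²u/∂x₁² + ∂²u/∂x₂²`. -/
noncomputable def lap (u : E2 → ℝ) (x : E2) : ℝ :=
  ∑ i : Fin 2, fderiv ℝ (fun y => fderiv ℝ u y (EuclideanSpace.single i 1)) x
    (EuclideanSpace.single i 1)

/-! ### Integrals over a period depending on a parameter -/

theorem continuousOn_integral_period {S : Set ℝ} {F : ℝ → ℝ → ℝ}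
    (hF : ContinuousOn (Function.uncurry F) (S ×ˢ Set.univ)) :
    ContinuousOn (fun s => ∫ θ in (-π)..π, F s θ) S := by
  rw [continuousOn_iff_continuous_domRestrict]
  refine intervalIntegral.continuous_parametric_intervalIntegral_of_continuous'
    (f := fun (s : S) θ => F s θ) ?_ _ _
  exact hF.comp_continuous (f := fun q : S × ℝ => ((q.1 : ℝ), q.2)) (by fun_prop)
    (fun q => ⟨q.1.2, Set.mem_univ _⟩)

theorem hasDerivAt_integral_period {S : Set ℝ} (hS : IsOpen S) {F F' : ℝ → ℝ → ℝ}
    (hF : ContinuousOn (Function.uncurry F) (S ×ˢ Set.univ))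
    (hF' : ContinuousOn (Function.uncurry F') (S ×ˢ Set.univ))
    (hd : ∀ t ∈ S, ∀ θ, HasDerivAt (fun s => F s θ) (F' t θ) t) {t : ℝ} (ht : t ∈ S) :
    HasDerivAt (fun s => ∫ θ in (-π)..π, F s θ) (∫ θ in (-π)..π, F' t θ) t := by
  obtain ⟨ε, hε, hball⟩ := Metric.nhds_basis_closedBall.mem_iff.1 (hS.mem_nhds ht)
  have hsec : ∀ {G : ℝ → ℝ → ℝ}, ContinuousOn (Function.uncurry G) (S ×ˢ Set.univ) →
      ∀ s ∈ S, Continuous (G s) := fun {G} hG s hs =>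
    hG.comp_continuous (f := fun θ : ℝ => (s, θ)) (by fun_prop) (fun θ => ⟨hs, Set.mem_univ _⟩)
  obtain ⟨C, hC⟩ := ((isCompact_closedBall t ε).prod
    (isCompact_uIcc (a := -π) (b := π))).exists_bound_of_continuousOn
    (hF'.mono (Set.prod_mono hball (Set.subset_univ _)))
  refine (intervalIntegral.hasDerivAt_integral_of_dominated_loc_of_deriv_le
    (bound := fun _ => C) (closedBall_mem_nhds t hε) ?_ ?_ ?_ ?_ ?_ ?_).2
  · filter_upwards [hS.mem_nhds ht] with s hs
    exact (hsec hF s hs).aestronglyMeasurable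
  · exact (hsec hF t ht).intervalIntegrable _ _
  · exact (hsec hF' t ht).aestronglyMeasurable
  · exact ae_of_all _ fun θ hθ s hs => hC (s, θ) ⟨hs, Set.uIoc_subset_uIcc hθ⟩
  · exact intervalIntegrable_const
  · exact ae_of_all _ fun θ _ s hs => hd s (hball hs) θ

/-! ### Logarithmic polar coordinates -/

/-- The unit radial vector of angle `θ`. -/
def radial (θ : ℝ) : E2 := !₂[cos θ, sin θ]

/-- The unit angular vector of angle `θ`. -/
def angular (θ : ℝ) : E2 := !₂[-sin θ, cos θ]

/-- The point with logarithmic polar coordinates `(t, θ)` about `c`. -/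
def polarPt (c : E2) (t θ : ℝ) : E2 := c + exp t • radial θ

theorem radial_eq (θ : ℝ) : radial θ =
    cos θ • EuclideanSpace.single 0 1 + sin θ • EuclideanSpace.single 1 1 := by
  ext i; fin_cases i <;> simp [radial]

theorem angular_eq (θ : ℝ) : angular θ =
    (-sin θ) • EuclideanSpace.single 0 1 + cos θ • EuclideanSpace.single 1 1 := by
  ext i; fin_cases i <;> simp [angular]

@[simp] theorem norm_radial (θ : ℝ) : ‖radial θ‖ = 1 := by
  simp [radial, EuclideanSpace.norm_eq, Fin.sum_univ_two]

theorem hasDerivAt_radial (θ : ℝ) : HasDerivAt radial (angular θ) θ := by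
  rw [angular_eq]
  have := ((hasDerivAt_cos θ).smul_const (EuclideanSpace.single 0 1 : E2)).add
    ((hasDerivAt_sin θ).smul_const (EuclideanSpace.single 1 1 : E2))
  refine this.congr_of_eventuallyEq (Eventually.of_forall fun s => ?_)
  simp [radial_eq]

theorem hasDerivAt_angular (θ : ℝ) : HasDerivAt angular (-radial θ) θ := by
  rw [radial_eq, neg_add, ← neg_smul, ← neg_smul]
  have := ((hasDerivAt_sin θ).neg.smul_const (EuclideanSpace.single 0 1 : E2)).add
    ((hasDerivAt_cos θ).smul_const (EuclideanSpace.single 1 1 : E2))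
  refine this.congr_of_eventuallyEq (Eventually.of_forall fun s => ?_)
  simp [angular_eq]

@[fun_prop] theorem continuous_radial : Continuous radial :=
  continuous_iff_continuousAt.2 fun θ => (hasDerivAt_radial θ).continuousAt

@[fun_prop] theorem continuous_angular : Continuous angular :=
  continuous_iff_continuousAt.2 fun θ => (hasDerivAt_angular θ).continuousAt

theorem radial_periodic : Function.Periodic radial (2 * π) := fun θ => by simp [radial]

theorem angular_periodic : Function.Periodic angular (2 * π) := fun θ => by simp [angular]

theorem norm_polarPt_sub (c : E2) (t θ : ℝ) : ‖polarPt c t θ - c‖ = exp t := by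
  simp [polarPt, norm_smul]

theorem dist_polarPt (c : E2) (t θ : ℝ) : dist (polarPt c t θ) c = exp t := by
  rw [dist_eq_norm, norm_polarPt_sub]

theorem continuous_polarPt (c : E2) : Continuous fun q : ℝ × ℝ => polarPt c q.1 q.2 := by
  unfold polarPt; fun_prop

theorem polarPt_periodic (c : E2) (t : ℝ) : Function.Periodic (polarPt c t) (2 * π) := fun θ => by
  simp [polarPt, radial_periodic θ]

theorem hasDerivAt_polarPt_left (c : E2) (t θ : ℝ) :
    HasDerivAt (fun s => polarPt c s θ) (exp t • radial θ) t :=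
  ((hasDerivAt_exp t).smul_const (radial θ)).const_add c

theorem hasDerivAt_polarPt_right (c : E2) (t θ : ℝ) :
    HasDerivAt (polarPt c t) (exp t • angular θ) θ :=
  ((hasDerivAt_radial θ).const_smul (exp t)).const_add c

/-- The cosine coefficient with phase `φ` of the restriction of `v` to the circle of centre `c` and
radius `exp t`. -/
def circleCoeff (v : E2 → ℝ) (c : E2) (n : ℕ) (φ t : ℝ) : ℝ :=
  ∫ θ in (-π)..π, v (polarPt c t θ) * cos (n * θ + φ)

/-- The derivative of `circleCoeff` in the logarithmic radius. -/
def circleCoeffDeriv (v : E2 → ℝ) (c : E2) (n : ℕ) (φ t : ℝ) : ℝ :=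
  ∫ θ in (-π)..π, fderiv ℝ v (polarPt c t θ) (exp t • radial θ) * cos (n * θ + φ)

section Coefficients

variable {v : E2 → ℝ} {Ω : Set E2} {c : E2} {S : Set ℝ}

theorem contDiffOn_fderiv (hΩ : IsOpen Ω) (hv : ContDiffOn ℝ 2 v Ω) :
    ContDiffOn ℝ 1 (fderiv ℝ v) Ω :=
  hv.fderiv_of_isOpen hΩ (by norm_num)

theorem lap_eq (hΩ : IsOpen Ω) (hv : ContDiffOn ℝ 2 v Ω) {x : E2} (hx : x ∈ Ω) :
    lap v x = ∑ i : Fin 2, fderiv ℝ (fderiv ℝ v) x (EuclideanSpace.single i 1)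
      (EuclideanSpace.single i 1) := by
  unfold lap
  refine Finset.sum_congr rfl fun i _ => ?_
  have h := ((contDiffOn_fderiv hΩ hv).differentiableOn one_ne_zero).differentiableAt
    (hΩ.mem_nhds hx)
  rw [fderiv_clm_apply h (differentiableAt_const _)]
  simp

theorem continuousOn_lap (hΩ : IsOpen Ω) (hv : ContDiffOn ℝ 2 v Ω) : ContinuousOn (lap v) Ω := by
  have h : ContinuousOn (fderiv ℝ (fderiv ℝ v)) Ω :=
    (contDiffOn_fderiv hΩ hv).continuousOn_fderiv_of_isOpen hΩ le_rfl
  refine ContinuousOn.congr (f := fun x => ∑ i : Fin 2, fderiv ℝ (fderiv ℝ v) x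
    (EuclideanSpace.single i 1) (EuclideanSpace.single i 1)) ?_ fun x hx => lap_eq hΩ hv hx
  fun_prop

theorem hasDerivAt_circleCoeff (hΩ : IsOpen Ω) (hv : ContDiffOn ℝ 2 v Ω) (hS : IsOpen S)
    (hmem : ∀ t ∈ S, ∀ θ, polarPt c t θ ∈ Ω) (n : ℕ) (φ : ℝ) {t : ℝ} (ht : t ∈ S) :
    HasDerivAt (circleCoeff v c n φ) (circleCoeffDeriv v c n φ t) t := by
  have hpt : ContinuousOn (fun q : ℝ × ℝ => polarPt c q.1 q.2) (S ×ˢ Set.univ) :=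
    (continuous_polarPt c).continuousOn
  have hmaps : Set.MapsTo (fun q : ℝ × ℝ => polarPt c q.1 q.2) (S ×ˢ Set.univ) Ω :=
    fun q hq => hmem q.1 hq.1 q.2
  have hv0 := hv.continuousOn.comp hpt hmaps
  have hv1 := (contDiffOn_fderiv hΩ hv).continuousOn.comp hpt hmaps
  refine hasDerivAt_integral_period hS (F := fun t θ => v (polarPt c t θ) * cos (n * θ + φ))
    (F' := fun t θ => fderiv ℝ v (polarPt c t θ) (exp t • radial θ) * cos (n * θ + φ)) ?_ ?_ ?_ ht
  · exact hv0.mul (by fun_prop)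
  · exact (hv1.clm_apply (by fun_prop)).mul (by fun_prop)
  · intro t ht θ
    have h := ((hv.differentiableOn two_ne_zero).differentiableAt
      (hΩ.mem_nhds (hmem t ht θ))).hasFDerivAt
    exact (h.comp_hasDerivAt t (hasDerivAt_polarPt_left c t θ)).mul_const _

theorem integral_angular_deriv (hΩ : IsOpen Ω) (hv : ContDiffOn ℝ 2 v Ω) {t : ℝ}
    (hmem : ∀ θ, polarPt c t θ ∈ Ω) (n : ℕ) (φ : ℝ) :
    ∫ θ in (-π)..π, ((fderiv ℝ (fderiv ℝ v) (polarPt c t θ) (exp t • angular θ)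
        (exp t • angular θ) - fderiv ℝ v (polarPt c t θ) (exp t • radial θ)) * cos (n * θ + φ)
        + (n : ℝ) ^ 2 * (v (polarPt c t θ) * cos (n * θ + φ))) = 0 := by
  have hpt : Continuous (polarPt c t) :=
    (continuous_polarPt c).comp (f := fun θ : ℝ => (t, θ)) (by fun_prop)
  have hv0 : Continuous fun θ => v (polarPt c t θ) := hv.continuousOn.comp_continuous hpt hmem
  have hv1 : Continuous fun θ => fderiv ℝ v (polarPt c t θ) :=
    (contDiffOn_fderiv hΩ hv).continuousOn.comp_continuous hpt hmem
  have hv2 : Continuous fun θ => fderiv ℝ (fderiv ℝ v) (polarPt c t θ) :=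
    ((contDiffOn_fderiv hΩ hv).continuousOn_fderiv_of_isOpen hΩ le_rfl).comp_continuous hpt hmem
  have key : ∀ θ, HasDerivAt (fun θ => fderiv ℝ v (polarPt c t θ) (exp t • angular θ)
      * cos (n * θ + φ) + v (polarPt c t θ) * (n * sin (n * θ + φ)))
      ((fderiv ℝ (fderiv ℝ v) (polarPt c t θ) (exp t • angular θ)
        (exp t • angular θ) - fderiv ℝ v (polarPt c t θ) (exp t • radial θ)) * cos (n * θ + φ)
        + (n : ℝ) ^ 2 * (v (polarPt c t θ) * cos (n * θ + φ))) θ := by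
    intro θ
    have hx := hΩ.mem_nhds (hmem θ)
    have h1 := ((hv.differentiableOn two_ne_zero).differentiableAt hx).hasFDerivAt.comp_hasDerivAt
      θ (hasDerivAt_polarPt_right c t θ)
    have h2 := (((contDiffOn_fderiv hΩ hv).differentiableOn one_ne_zero).differentiableAt
      hx).hasFDerivAt.comp_hasDerivAt θ (hasDerivAt_polarPt_right c t θ)
    have h3 := h2.clm_apply ((hasDerivAt_angular θ).const_smul (exp t))
    have hl : HasDerivAt (fun θ : ℝ => (n : ℝ) * θ + φ) n θ := by
      simpa using ((hasDerivAt_id θ).const_mul (n : ℝ)).add_const φ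
    have h4 := (h3.mul hl.cos).add (h1.mul (hl.sin.const_mul (n : ℝ)))
    refine h4.congr_deriv ?_
    simp only [Pi.smul_apply, Function.comp_apply, smul_neg, map_neg]
    ring
  have hcont : Continuous fun θ => (fderiv ℝ (fderiv ℝ v) (polarPt c t θ) (exp t • angular θ)
        (exp t • angular θ) - fderiv ℝ v (polarPt c t θ) (exp t • radial θ)) * cos (n * θ + φ)
        + (n : ℝ) ^ 2 * (v (polarPt c t θ) * cos (n * θ + φ)) :=
    ((((hv2.clm_apply (by fun_prop)).clm_apply (by fun_prop)).sub
      (hv1.clm_apply (by fun_prop))).mul (by fun_prop)).add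
      (continuous_const.mul (hv0.mul (by fun_prop)))
  rw [intervalIntegral.integral_eq_sub_of_hasDerivAt (fun θ _ => key θ)
    (hcont.intervalIntegrable _ _)]
  have e1 : polarPt c t π = polarPt c t (-π) := by
    rw [← polarPt_periodic c t (-π)]; congr 1; ring
  have e2 : angular π = angular (-π) := by rw [← angular_periodic (-π)]; congr 1; ring
  have e3 : (n : ℝ) * π + φ = (n * (-π) + φ) + n * (2 * π) := by ring
  rw [e1, e2, e3, cos_add_nat_mul_two_pi, sin_add_nat_mul_two_pi, sub_self]

theorem hasDerivAt_circleCoeffDeriv (hΩ : IsOpen Ω) (hv : ContDiffOn ℝ 2 v Ω) (hS : IsOpen S)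
    (hmem : ∀ t ∈ S, ∀ θ, polarPt c t θ ∈ Ω) (n : ℕ) (φ : ℝ) {t : ℝ} (ht : t ∈ S) :
    HasDerivAt (circleCoeffDeriv v c n φ) ((n : ℝ) ^ 2 * circleCoeff v c n φ t
      + exp (2 * t) * ∫ θ in (-π)..π, lap v (polarPt c t θ) * cos (n * θ + φ)) t := by
  have hpt : ContinuousOn (fun q : ℝ × ℝ => polarPt c q.1 q.2) (S ×ˢ Set.univ) :=
    (continuous_polarPt c).continuousOn
  have hmaps : Set.MapsTo (fun q : ℝ × ℝ => polarPt c q.1 q.2) (S ×ˢ Set.univ) Ω :=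
    fun q hq => hmem q.1 hq.1 q.2
  have hv1 := (contDiffOn_fderiv hΩ hv).continuousOn.comp hpt hmaps
  have hv2 := ((contDiffOn_fderiv hΩ hv).continuousOn_fderiv_of_isOpen hΩ le_rfl).comp
    hpt hmaps
  have main := hasDerivAt_integral_period hS
    (F := fun t θ => fderiv ℝ v (polarPt c t θ) (exp t • radial θ) * cos (n * θ + φ))
    (F' := fun t θ => (fderiv ℝ (fderiv ℝ v) (polarPt c t θ) (exp t • radial θ) (exp t • radial θ)
      + fderiv ℝ v (polarPt c t θ) (exp t • radial θ)) * cos (n * θ + φ))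
    ((hv1.clm_apply (by fun_prop)).mul (by fun_prop))
    ((((hv2.clm_apply (by fun_prop)).clm_apply (by fun_prop)).add
      (hv1.clm_apply (by fun_prop))).mul (by fun_prop)) (fun t ht θ => by
      have h2 := (((contDiffOn_fderiv hΩ hv).differentiableOn one_ne_zero).differentiableAt
        (hΩ.mem_nhds (hmem t ht θ))).hasFDerivAt.comp_hasDerivAt t (hasDerivAt_polarPt_left c t θ)
      exact (h2.clm_apply ((hasDerivAt_exp t).smul_const (radial θ))).mul_const _) ht
  refine HasDerivAt.congr_deriv main ?_
  have hptc : Continuous (polarPt c t) :=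
    (continuous_polarPt c).comp (f := fun θ : ℝ => (t, θ)) (by fun_prop)
  have c0 : Continuous fun θ => v (polarPt c t θ) := hv.continuousOn.comp_continuous hptc (hmem t ht)
  have c1 : Continuous fun θ => fderiv ℝ v (polarPt c t θ) :=
    (contDiffOn_fderiv hΩ hv).continuousOn.comp_continuous hptc (hmem t ht)
  have c2 : Continuous fun θ => fderiv ℝ (fderiv ℝ v) (polarPt c t θ) :=
    ((contDiffOn_fderiv hΩ hv).continuousOn_fderiv_of_isOpen hΩ le_rfl).comp_continuous hptc
      (hmem t ht)
  have c3 : Continuous fun θ => lap v (polarPt c t θ) :=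
    (continuousOn_lap hΩ hv).comp_continuous hptc (hmem t ht)
  have hz := integral_angular_deriv hΩ hv (hmem t ht) n φ
  have hP : Continuous fun θ => (n : ℝ) ^ 2 * (v (polarPt c t θ) * cos (n * θ + φ)) :=
    continuous_const.mul (c0.mul (by fun_prop))
  have hQ : Continuous fun θ => exp (2 * t) * (lap v (polarPt c t θ) * cos (n * θ + φ)) :=
    continuous_const.mul (c3.mul (by fun_prop))
  have hZ : Continuous fun θ => (fderiv ℝ (fderiv ℝ v) (polarPt c t θ) (exp t • angular θ)
        (exp t • angular θ) - fderiv ℝ v (polarPt c t θ) (exp t • radial θ)) * cos (n * θ + φ)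
        + (n : ℝ) ^ 2 * (v (polarPt c t θ) * cos (n * θ + φ)) :=
    ((((c2.clm_apply (by fun_prop)).clm_apply (by fun_prop)).sub
      (c1.clm_apply (by fun_prop))).mul (by fun_prop)).add hP
  unfold circleCoeff
  rw [← intervalIntegral.integral_const_mul, ← intervalIntegral.integral_const_mul,
    ← intervalIntegral.integral_add (hP.intervalIntegrable _ _) (hQ.intervalIntegrable _ _),
    ← sub_zero (∫ θ in (-π)..π, _ + _), ← hz, ← intervalIntegral.integral_sub
      ((hP.fun_add hQ).intervalIntegrable _ _) (hZ.intervalIntegrable _ _)]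
  refine intervalIntegral.integral_congr fun θ _ => ?_
  have hexp : exp (2 * t) = exp t ^ 2 := by rw [← exp_nat_mul]; norm_num
  simp only [lap_eq hΩ hv (hmem t ht θ), Fin.sum_univ_two, angular_eq, radial_eq, map_add, map_smul,
    add_apply, smul_apply, smul_eq_mul, hexp, smul_add]
  have := sin_sq_add_cos_sq θ
  set A := fderiv ℝ (fderiv ℝ v) (polarPt c t θ) (EuclideanSpace.single 0 1)
    (EuclideanSpace.single 0 1)
  set B := fderiv ℝ (fderiv ℝ v) (polarPt c t θ) (EuclideanSpace.single 1 1)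
    (EuclideanSpace.single 1 1)
  linear_combination ((A + B) * exp t ^ 2 * cos (n * θ + φ)) * this

end Coefficients

/-! ### Integration in polar coordinates -/

theorem integral_eq_integral_radial (f : E2 → ℝ) :
    ∫ x, f x = ∫ p in polarCoord.target, p.1 • f (p.1 • radial p.2) := by
  have h := (Complex.orthonormalBasisOneI.repr).measurePreserving
  rw [← h.integral_comp (Complex.orthonormalBasisOneI.repr).toHomeomorph.measurableEmbedding,
    ← Complex.integral_comp_polarCoord_symm]
  congr 1 with p
  congr 2
  ext i
  fin_cases i <;> simp [radial, Complex.cos_ofReal_re, Complex.sin_ofReal_re]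

theorem exists_eq_polarPt {c x : E2} (hx : x ≠ c) : ∃ θ, x = polarPt c (log ‖x - c‖) θ := by
  have hx0 : 0 < ‖x - c‖ := norm_pos_iff.2 (sub_ne_zero.2 hx)
  obtain ⟨z, hz⟩ := Complex.orthonormalBasisOneI.repr.surjective (x - c)
  have hzn : ‖x - c‖ = ‖z‖ := by rw [← hz, LinearIsometryEquiv.norm_map]
  refine ⟨Complex.arg z, ?_⟩
  rw [polarPt, exp_log hx0, ← sub_eq_iff_eq_add', hzn, ← hz]
  ext i
  have h1 := Complex.norm_mul_cos_arg z
  have h2 := Complex.norm_mul_sin_arg z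
  fin_cases i <;> simp [radial, h1, h2]

theorem integral_log_polar_le {f : E2 → ℝ} {s : Set E2} (hf : ∀ x, 0 ≤ f x)
    (hfi : IntegrableOn f s) (hfc : ContinuousOn f s) {c : E2} {a b : ℝ}
    (hab : a ≤ b) (hmem : ∀ t ∈ Set.Icc a b, ∀ θ, polarPt c t θ ∈ s) :
    ∫ t in a..b, exp (2 * t) * ∫ θ in (-π)..π, f (polarPt c t θ) ≤ ∫ x in s, f x := by
  set A : Set E2 := {x | exp a < ‖x - c‖ ∧ ‖x - c‖ < exp b} with hA
  have hAm : MeasurableSet A :=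
    ((isOpen_lt (f := fun _ => exp a) (g := fun x : E2 => ‖x - c‖) (by fun_prop)
      (by fun_prop)).inter (isOpen_lt (f := fun x : E2 => ‖x - c‖) (g := fun _ => exp b)
      (by fun_prop) (by fun_prop))).measurableSet
  have hab' : exp a ≤ exp b := exp_le_exp.2 hab
  have hin : ∀ r ∈ Set.Icc (exp a) (exp b), ∀ θ, c + r • radial θ ∈ s := by
    intro r hr θ
    have hr0 : 0 < r := (exp_pos a).trans_le hr.1
    have := hmem (log r) ⟨(le_log_iff_exp_le hr0).2 hr.1, (log_le_iff_le_exp hr0).2 hr.2⟩ θ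
    rwa [polarPt, exp_log hr0] at this
  have hAs : A ⊆ s := by
    intro x hx
    have hx0 : 0 < ‖x - c‖ := (exp_pos a).trans hx.1
    obtain ⟨θ, hθ⟩ := exists_eq_polarPt (sub_ne_zero.1 (norm_pos_iff.1 hx0))
    rw [hθ]
    exact hmem _ ⟨(le_log_iff_exp_le hx0).2 hx.1.le, (log_le_iff_le_exp hx0).2 hx.2.le⟩ θ
  have hcont : ContinuousOn (fun q : ℝ × ℝ => q.1 * f (c + q.1 • radial q.2))
      (Set.Icc (exp a) (exp b) ×ˢ Set.univ) :=
    continuousOn_fst.mul (hfc.comp (by fun_prop) fun q hq => hin q.1 hq.1 q.2)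
  have hAeq : ∫ x in A, f x =
      ∫ r in (exp a)..(exp b), ∫ θ in (-π)..π, r * f (c + r • radial θ) := by
    rw [← integral_indicator hAm, ← integral_add_left_eq_self _ c, integral_eq_integral_radial]
    have h1 : ∀ p ∈ polarCoord.target, p.1 • A.indicator f (c + p.1 • radial p.2) =
        (Set.Ioo (exp a) (exp b) ×ˢ Set.univ).indicator
          (fun q : ℝ × ℝ => q.1 * f (c + q.1 • radial q.2)) p := by
      intro p hp
      rw [polarCoord_target] at hp
      have hp0 : 0 < p.1 := hp.1
      have hnorm : ‖c + p.1 • radial p.2 - c‖ = p.1 := by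
        rw [add_sub_cancel_left, norm_smul, norm_radial, mul_one, norm_of_nonneg hp0.le]
      by_cases h : p.1 ∈ Set.Ioo (exp a) (exp b)
      · rw [Set.indicator_of_mem (show _ ∈ A by rw [hA, Set.mem_ofPred_eq, hnorm]; exact h),
          Set.indicator_of_mem (Set.mk_mem_prod h (Set.mem_univ p.2)), smul_eq_mul]
      · rw [Set.indicator_of_notMem (show _ ∉ A by
          rw [hA, Set.mem_ofPred_eq, hnorm]; exact h),
          Set.indicator_of_notMem (fun h' => h h'.1), smul_zero]
    rw [setIntegral_congr_fun polarCoord.open_target.measurableSet h1,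
      setIntegral_indicator (measurableSet_Ioo.prod MeasurableSet.univ), polarCoord_target,
      Set.prod_inter_prod, Set.inter_univ, Set.inter_eq_right.2
        (show Set.Ioo (exp a) (exp b) ⊆ Set.Ioi 0 from fun r hr => (exp_pos a).trans hr.1), Measure.volume_eq_prod, setIntegral_prod,
      intervalIntegral.integral_of_le hab', integral_Ioc_eq_integral_Ioo]
    · refine setIntegral_congr_fun measurableSet_Ioo fun r _ => ?_
      rw [intervalIntegral.integral_of_le (by linarith [pi_pos]), integral_Ioc_eq_integral_Ioo]
    · exact ((hcont.mono (Set.prod_mono le_rfl (Set.subset_univ _))).integrableOn_compact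
        (isCompact_Icc.prod (isCompact_Icc (a := -π) (b := π)))).mono_set
        (Set.prod_mono Set.Ioo_subset_Icc_self Set.Ioo_subset_Icc_self)
  have hsub := intervalIntegral.integral_comp_mul_deriv' (a := a) (b := b) (f := exp) (f' := exp)
    (g := fun r => ∫ θ in (-π)..π, r * f (c + r • radial θ)) (fun t _ => hasDerivAt_exp t)
    continuous_exp.continuousOn (by
      refine (continuousOn_integral_period (S := Set.Icc (exp a) (exp b))
        (F := fun r θ => r * f (c + r • radial θ)) hcont).mono ?_
      rintro _ ⟨t, ht, rfl⟩
      rw [Set.uIcc_of_le hab] at ht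
      exact ⟨exp_le_exp.2 ht.1, exp_le_exp.2 ht.2⟩)
  refine le_trans (le_of_eq ?_) (setIntegral_mono_set hfi (ae_of_all _ hf) hAs.eventuallyLE)
  rw [hAeq, ← hsub]
  refine intervalIntegral.integral_congr fun t _ => ?_
  have hexp : exp (2 * t) = exp t ^ 2 := by rw [← exp_nat_mul]; norm_num
  simp only [Function.comp_apply, intervalIntegral.integral_const_mul, polarPt, hexp]
  ring

/-! ### Local estimates from circle averages -/

theorem monotoneOn_Iio_of_hasDerivAt {f f' : ℝ → ℝ} {T : ℝ}
    (hf : ∀ t < T, HasDerivAt f (f' t) t) (hf' : ∀ t < T, 0 ≤ f' t) : MonotoneOn f (Set.Iio T) := by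
  refine monotoneOn_of_hasDerivWithinAt_nonneg (f' := f') (convex_Iio T)
    (fun t ht => (hf t ht).continuousAt.continuousWithinAt) ?_ ?_ <;> rw [interior_Iio]
  · exact fun t ht => (hf t ht).hasDerivWithinAt
  · exact hf'

theorem le_of_hasDerivAt_of_tendsto_atBot {f f' : ℝ → ℝ} {T l : ℝ}
    (hf : ∀ t < T, HasDerivAt f (f' t) t) (hf' : ∀ t < T, 0 ≤ f' t)
    (hl : Tendsto f atBot (𝓝 l)) {t : ℝ} (ht : t < T) : l ≤ f t := by
  refine le_of_tendsto hl ?_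
  filter_upwards [eventually_le_atBot t] with s hs
  exact monotoneOn_Iio_of_hasDerivAt hf hf' (hs.trans_lt ht) ht hs

theorem tendsto_integral_polarPt_atBot {Ω : Set E2} (hΩ : IsOpen Ω) {G : E2 → ℝ → ℝ}
    (hG : ContinuousOn (Function.uncurry G) (Ω ×ˢ Set.univ)) {c : E2} (hc : c ∈ Ω) :
    Tendsto (fun t => ∫ θ in (-π)..π, G (polarPt c t θ) θ) atBot
      (𝓝 (∫ θ in (-π)..π, G c θ)) := by
  obtain ⟨ρ, hρ, hball⟩ := Metric.isOpen_iff.1 hΩ c hc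
  have hmem : ∀ r ∈ Set.Ioo (-ρ) ρ, ∀ θ, c + r • radial θ ∈ Ω := by
    intro r hr θ
    refine hball ?_
    rw [mem_ball, dist_eq_norm, add_sub_cancel_left, norm_smul, norm_radial, mul_one]
    exact abs_lt.2 hr
  have h := continuousOn_integral_period (S := Set.Ioo (-ρ) ρ)
    (F := fun r θ => G (c + r • radial θ) θ)
    (hG.comp (f := fun q : ℝ × ℝ => (c + q.1 • radial q.2, q.2)) (by fun_prop)
      (fun q hq => ⟨hmem q.1 hq.1 q.2, Set.mem_univ _⟩))
  have h0 := (h.continuousAt (Ioo_mem_nhds (neg_lt_zero.2 hρ) hρ)).tendsto.comp tendsto_exp_atBot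
  simpa [Function.comp_def, polarPt] using h0

section Local

variable {v : E2 → ℝ} {Ω : Set E2} {c : E2} {T : ℝ}

theorem polarPt_mem_ball (c : E2) {t : ℝ} (ht : t < T) (θ : ℝ) : polarPt c t θ ∈ ball c (exp T) := by
  rw [mem_ball, dist_polarPt]; exact exp_lt_exp.2 ht

theorem circleCoeffDeriv_eq (n : ℕ) (φ t : ℝ) : circleCoeffDeriv v c n φ t =
    exp t * ∫ θ in (-π)..π, fderiv ℝ v (polarPt c t θ) (radial θ) * cos (n * θ + φ) := by
  unfold circleCoeffDeriv
  rw [← intervalIntegral.integral_const_mul]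
  simp only [map_smul, smul_eq_mul, mul_assoc]

theorem tendsto_circleCoeff_atBot (hΩ : IsOpen Ω) (hv : ContDiffOn ℝ 2 v Ω) (hc : c ∈ Ω)
    (n : ℕ) (φ : ℝ) : Tendsto (circleCoeff v c n φ) atBot
      (𝓝 (∫ θ in (-π)..π, v c * cos (n * θ + φ))) := by
  refine tendsto_integral_polarPt_atBot hΩ (G := fun x θ => v x * cos (n * θ + φ)) ?_ hc
  exact (hv.continuousOn.comp continuousOn_fst fun q hq => hq.1).mul (by fun_prop)

theorem tendsto_circleCoeffDeriv_atBot (hΩ : IsOpen Ω) (hv : ContDiffOn ℝ 2 v Ω) (hc : c ∈ Ω)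
    (n : ℕ) (φ : ℝ) : Tendsto (fun t => exp (-t) * circleCoeffDeriv v c n φ t) atBot
      (𝓝 (∫ θ in (-π)..π, fderiv ℝ v c (radial θ) * cos (n * θ + φ))) := by
  have h := tendsto_integral_polarPt_atBot hΩ
    (G := fun x θ => fderiv ℝ v x (radial θ) * cos (n * θ + φ))
    ((((contDiffOn_fderiv hΩ hv).continuousOn.comp continuousOn_fst fun q hq => hq.1).clm_apply
      (by fun_prop)).mul (by fun_prop)) hc
  refine h.congr fun t => ?_
  rw [circleCoeffDeriv_eq, ← mul_assoc, ← exp_add, neg_add_cancel, exp_zero, one_mul]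

theorem tendsto_circleCoeffDeriv_atBot_zero (hΩ : IsOpen Ω) (hv : ContDiffOn ℝ 2 v Ω) (hc : c ∈ Ω)
    (n : ℕ) (φ : ℝ) : Tendsto (circleCoeffDeriv v c n φ) atBot (𝓝 0) := by
  have h := tendsto_exp_atBot.mul (tendsto_circleCoeffDeriv_atBot hΩ hv hc n φ)
  rw [zero_mul] at h
  refine h.congr fun t => ?_
  rw [← mul_assoc, ← exp_add, add_neg_cancel, exp_zero, one_mul]

theorem two_pi_mul_sub_le_integral (hΩ : IsOpen Ω) (hv : ContDiffOn ℝ 2 v Ω)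
    (hball : ball c (exp T) ⊆ Ω) {K : ℝ} (hK : ∀ x ∈ ball c (exp T), -K ≤ lap v x) {t : ℝ}
    (ht : t < T) : 2 * π * v c - π / 2 * K * exp (2 * t) ≤ ∫ θ in (-π)..π, v (polarPt c t θ) := by
  have hc : c ∈ Ω := hball (mem_ball_self (exp_pos T))
  have hmem : ∀ t ∈ Set.Iio T, ∀ θ, polarPt c t θ ∈ Ω := fun t ht θ =>
    hball (polarPt_mem_ball c ht θ)
  have hE : ∀ t : ℝ, HasDerivAt (fun t => exp (2 * t)) (2 * exp (2 * t)) t := fun t => by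
    simpa [mul_comm] using ((hasDerivAt_id t).const_mul 2).exp
  have hE0 : Tendsto (fun t => exp (2 * t)) atBot (𝓝 0) :=
    tendsto_exp_atBot.comp (tendsto_id.const_mul_atBot two_pos)
  have hN2 : ∀ t < T, HasDerivAt (fun t => circleCoeffDeriv v c 0 0 t + π * K * exp (2 * t))
      (exp (2 * t) * (∫ θ in (-π)..π, lap v (polarPt c t θ)) + 2 * π * K * exp (2 * t)) t := by
    intro t ht
    refine ((hasDerivAt_circleCoeffDeriv hΩ hv isOpen_Iio hmem 0 0 ht).add
      ((hE t).const_mul (π * K))).congr_deriv ?_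
    simp; ring
  have hN2' : ∀ t < T, 0 ≤ exp (2 * t) * (∫ θ in (-π)..π, lap v (polarPt c t θ))
      + 2 * π * K * exp (2 * t) := by
    intro t ht
    have hcont : Continuous fun θ => lap v (polarPt c t θ) :=
      (continuousOn_lap hΩ hv).comp_continuous ((continuous_polarPt c).comp
        (f := fun θ : ℝ => (t, θ)) (by fun_prop)) (hmem t ht)
    have h := intervalIntegral.integral_mono_on (μ := volume) (a := -π) (b := π)
      (f := fun _ => -K)
      (by linarith [pi_pos]) intervalIntegrable_const (hcont.intervalIntegrable _ _)
      (fun θ _ => hK _ (polarPt_mem_ball c ht θ))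
    rw [intervalIntegral.integral_const, smul_eq_mul] at h
    nlinarith [exp_pos (2 * t)]
  have hN1' : ∀ t < T, 0 ≤ circleCoeffDeriv v c 0 0 t + π * K * exp (2 * t) := fun t ht =>
    le_of_hasDerivAt_of_tendsto_atBot hN2 hN2' (by
      simpa using (tendsto_circleCoeffDeriv_atBot_zero hΩ hv hc 0 0).add (hE0.const_mul (π * K))) ht
  have hN1 : ∀ t < T, HasDerivAt (fun t => circleCoeff v c 0 0 t + π / 2 * K * exp (2 * t))
      (circleCoeffDeriv v c 0 0 t + π * K * exp (2 * t)) t := by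
    intro t ht
    refine ((hasDerivAt_circleCoeff hΩ hv isOpen_Iio hmem 0 0 ht).add
      ((hE t).const_mul (π / 2 * K))).congr_deriv ?_
    ring
  have h := le_of_hasDerivAt_of_tendsto_atBot hN1 hN1'
    ((tendsto_circleCoeff_atBot hΩ hv hc 0 0).add (hE0.const_mul (π / 2 * K))) ht
  simp [circleCoeff] at h
  linarith

theorem norm_le_of_apply_single (L : E2 →L[ℝ] ℝ) {B : ℝ}
    (h0 : |L (EuclideanSpace.single 0 1)| ≤ B) (h1 : |L (EuclideanSpace.single 1 1)| ≤ B) :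
    ‖L‖ ≤ 2 * B := by
  have hB : 0 ≤ B := (abs_nonneg _).trans h0
  refine L.opNorm_le_bound (by positivity) fun x => ?_
  have hx : x = x 0 • EuclideanSpace.single 0 1 + x 1 • EuclideanSpace.single 1 1 := by
    ext i; fin_cases i <;> simp
  have e0 := PiLp.norm_apply_le x 0
  have e1 := PiLp.norm_apply_le x 1
  rw [norm_eq_abs] at e0 e1
  calc ‖L x‖ = |x 0 * L (EuclideanSpace.single 0 1) + x 1 * L (EuclideanSpace.single 1 1)| := by
        conv_lhs => rw [hx]
        simp
    _ ≤ |x 0| * |L (EuclideanSpace.single 0 1)| + |x 1| * |L (EuclideanSpace.single 1 1)| := by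
        rw [← abs_mul, ← abs_mul]; exact abs_add_le _ _
    _ ≤ ‖x‖ * B + ‖x‖ * B := by gcongr
    _ = 2 * B * ‖x‖ := by ring

theorem abs_integral_period_le {f : ℝ → ℝ} {B : ℝ} (hf : ∀ θ, |f θ| ≤ B) :
    |∫ θ in (-π)..π, f θ| ≤ 2 * π * B := by
  have h := intervalIntegral.norm_integral_le_of_norm_le_const (a := -π) (b := π) (f := f)
    (fun θ _ => hf θ)
  rw [norm_eq_abs, abs_of_pos (by linarith [pi_pos] : (0 : ℝ) < π - -π)] at h
  linarith

theorem abs_mul_cos_le {a B : ℝ} (h : |a| ≤ B) (x : ℝ) : |a * cos x| ≤ B := by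
  rw [abs_mul]
  exact (mul_le_of_le_one_right (abs_nonneg a) (abs_cos_le_one x)).trans h

theorem abs_integral_fderiv_le (hΩ : IsOpen Ω) (hv : ContDiffOn ℝ 2 v Ω)
    (hball : ball c (exp T) ⊆ Ω) {A K : ℝ} (hA : ∀ x ∈ ball c (exp T), |v x| ≤ A)
    (hK : ∀ x ∈ ball c (exp T), |lap v x| ≤ K) (φ : ℝ) {t : ℝ} (ht : t < T) :
    |∫ θ in (-π)..π, fderiv ℝ v c (radial θ) * cos (θ + φ)| ≤
      2 * π * (A * exp (-t) + K * exp t) := by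
  have hc : c ∈ Ω := hball (mem_ball_self (exp_pos T))
  have hmem : ∀ t ∈ Set.Iio T, ∀ θ, polarPt c t θ ∈ Ω := fun t ht θ =>
    hball (polarPt_mem_ball c ht θ)
  have hK0 : 0 ≤ K := (abs_nonneg _).trans (hK c (mem_ball_self (exp_pos T)))
  set a := circleCoeff v c 1 φ with ha
  set a' := circleCoeffDeriv v c 1 φ with ha'
  set h : ℝ → ℝ := fun t => ∫ θ in (-π)..π, lap v (polarPt c t θ) * cos (((1 : ℕ) : ℝ) * θ + φ) with hh
  have da : ∀ t < T, HasDerivAt a (a' t) t := fun t ht =>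
    hasDerivAt_circleCoeff hΩ hv isOpen_Iio hmem 1 φ ht
  have da' : ∀ t < T, HasDerivAt a' (a t + exp (2 * t) * h t) t := fun t ht => by
    refine (hasDerivAt_circleCoeffDeriv hΩ hv isOpen_Iio hmem 1 φ ht).congr_deriv ?_
    simp [ha, hh]
  have ba : ∀ t < T, |a t| ≤ 2 * π * A := fun t ht =>
    abs_integral_period_le fun θ => abs_mul_cos_le (hA _ (polarPt_mem_ball c ht θ)) _
  have bh : ∀ t < T, |h t| ≤ 2 * π * K := fun t ht =>
    abs_integral_period_le fun θ => abs_mul_cos_le (hK _ (polarPt_mem_ball c ht θ)) _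
  have e2 : ∀ t : ℝ, exp (2 * t) = exp t ^ 2 := fun t => by rw [← exp_nat_mul]; norm_num
  have e3 : ∀ t : ℝ, exp (3 * t) = exp t ^ 3 := fun t => by rw [← exp_nat_mul]; norm_num
  have en : ∀ t : ℝ, exp t * exp (-t) = 1 := fun t => by rw [← exp_add]; simp
  have dE3 : ∀ t : ℝ, HasDerivAt (fun t => exp (3 * t)) (3 * exp (3 * t)) t := fun t => by
    simpa [mul_comm] using ((hasDerivAt_id t).const_mul 3).exp
  have dq : ∀ t < T, HasDerivAt (fun t => (a' t - a t) * exp t) (exp (3 * t) * h t) t := by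
    intro t ht
    refine (((da' t ht).sub (da t ht)).mul (hasDerivAt_exp t)).congr_deriv ?_
    simp only [Pi.sub_apply, e2, e3]; ring
  have a'0 : Tendsto a' atBot (𝓝 0) := tendsto_circleCoeffDeriv_atBot_zero hΩ hv hc 1 φ
  have a0 := tendsto_circleCoeff_atBot hΩ hv hc 1 φ
  have E30 : Tendsto (fun t => exp (3 * t)) atBot (𝓝 0) :=
    tendsto_exp_atBot.comp (tendsto_id.const_mul_atBot three_pos)
  have q0 : Tendsto (fun t => (a' t - a t) * exp t) atBot (𝓝 0) := by
    simpa using (a'0.sub a0).mul tendsto_exp_atBot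
  have bq : ∀ t < T, |(a' t - a t) * exp t| ≤ 2 * π * K / 3 * exp (3 * t) := by
    intro t ht
    rw [abs_le]
    constructor
    · have := le_of_hasDerivAt_of_tendsto_atBot (T := T) (l := 0)
        (f := fun t => (a' t - a t) * exp t + 2 * π * K / 3 * exp (3 * t))
        (fun t ht => (dq t ht).add ((dE3 t).const_mul (2 * π * K / 3)))
        (fun t ht => by nlinarith [(abs_le.1 (bh t ht)).1, exp_pos (3 * t)])
        (by simpa using q0.add (E30.const_mul (2 * π * K / 3))) ht
      linarith
    · have := le_of_hasDerivAt_of_tendsto_atBot (T := T) (l := 0)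
        (f := fun t => 2 * π * K / 3 * exp (3 * t) - (a' t - a t) * exp t)
        (fun t ht => ((dE3 t).const_mul (2 * π * K / 3)).sub (dq t ht))
        (fun t ht => by nlinarith [(abs_le.1 (bh t ht)).2, exp_pos (3 * t)])
        (by simpa using (E30.const_mul (2 * π * K / 3)).sub q0) ht
      linarith
  have bp' : ∀ t < T, |(a' t - a t) * exp (-t)| ≤ 2 * π * K / 3 * exp t := by
    intro t ht
    have h1 := bq t ht
    have h2 : (a' t - a t) * exp (-t) = (a' t - a t) * exp t * exp (-t) ^ 2 := by
      linear_combination (-(a' t - a t) * exp (-t)) * en t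
    have h3 : 2 * π * K / 3 * exp t = 2 * π * K / 3 * exp (3 * t) * exp (-t) ^ 2 := by
      rw [e3]
      linear_combination (-2 * π * K / 3 * exp t * (exp t * exp (-t) + 1)) * en t
    rw [h2, h3, abs_mul, abs_of_nonneg (sq_nonneg (exp (-t)))]
    exact mul_le_mul_of_nonneg_right h1 (sq_nonneg _)
  have dp : ∀ t < T, HasDerivAt (fun t => a t * exp (-t)) ((a' t - a t) * exp (-t)) t := by
    intro t ht
    refine ((da t ht).mul (hasDerivAt_neg t).exp).congr_deriv ?_
    ring
  have bp : ∀ s ≤ t, |a s * exp (-s)| ≤ 2 * π * A * exp (-t) + 2 * π * K / 3 * exp t := by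
    intro s hs
    have hst : |a t * exp (-t)| ≤ 2 * π * A * exp (-t) := by
      rw [abs_mul, abs_of_pos (exp_pos (-t))]
      exact mul_le_mul_of_nonneg_right (ba t ht) (exp_pos _).le
    have hK' : 0 ≤ 2 * π * K / 3 * exp s := by positivity
    have m1 := monotoneOn_Iio_of_hasDerivAt (T := T)
        (f := fun t => a t * exp (-t) + 2 * π * K / 3 * exp t)
        (fun t ht => (dp t ht).add ((hasDerivAt_exp t).const_mul (2 * π * K / 3)))
        (fun t ht => by linarith [(abs_le.1 (bp' t ht)).1]) (hs.trans_lt ht) ht hs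
    have m2 := monotoneOn_Iio_of_hasDerivAt (T := T)
        (f := fun t => 2 * π * K / 3 * exp t - a t * exp (-t))
        (fun t ht => ((hasDerivAt_exp t).const_mul (2 * π * K / 3)).sub (dp t ht))
        (fun t ht => by linarith [(abs_le.1 (bp' t ht)).2]) (hs.trans_lt ht) ht hs
    simp only at m1 m2
    rw [abs_le] at hst ⊢
    constructor <;> linarith
  have hlim := (tendsto_circleCoeffDeriv_atBot hΩ hv hc 1 φ).abs
  simp only [Nat.cast_one, one_mul] at hlim
  refine le_of_tendsto hlim ?_
  filter_upwards [eventually_le_atBot t] with s hs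
  have h1 := bp s hs
  have h2 := bp' s (hs.trans_lt ht)
  have h3 : exp (-s) * a' s = a s * exp (-s) + (a' s - a s) * exp (-s) := by ring
  have h4 : 2 * π * K / 3 * exp s ≤ 2 * π * K / 3 * exp t := by gcongr
  have h5 : 0 ≤ 2 * π * K / 3 * exp t := by positivity
  calc |exp (-s) * a' s| ≤ |a s * exp (-s)| + |(a' s - a s) * exp (-s)| := by
        rw [h3]; exact abs_add_le _ _
    _ ≤ 2 * π * (A * exp (-t) + K * exp t) := by linarith

/-- Interior gradient estimate for the Poisson equation. -/
theorem norm_fderiv_le (hΩ : IsOpen Ω) (hv : ContDiffOn ℝ 2 v Ω)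
    (hball : ball c (exp T) ⊆ Ω) {A K : ℝ} (hA : ∀ x ∈ ball c (exp T), |v x| ≤ A)
    (hK : ∀ x ∈ ball c (exp T), |lap v x| ≤ K) {t : ℝ} (ht : t < T) :
    ‖fderiv ℝ v c‖ ≤ 4 * (A * exp (-t) + K * exp t) := by
  have hrad : ∀ θ, fderiv ℝ v c (radial θ) = cos θ * fderiv ℝ v c (EuclideanSpace.single 0 1)
      + sin θ * fderiv ℝ v c (EuclideanSpace.single 1 1) := fun θ => by
    rw [radial_eq, map_add, map_smul, map_smul, smul_eq_mul, smul_eq_mul]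
  set p := fderiv ℝ v c (EuclideanSpace.single 0 1)
  set q := fderiv ℝ v c (EuclideanSpace.single 1 1)
  have h1 := abs_integral_fderiv_le hΩ hv hball hA hK 0 ht
  have h2 := abs_integral_fderiv_le hΩ hv hball hA hK (-(π / 2)) ht
  have i1 : ∫ θ in (-π)..π, fderiv ℝ v c (radial θ) * cos (θ + 0) = π * p := by
    have : ∀ θ, fderiv ℝ v c (radial θ) * cos (θ + 0) =
        p * cos θ ^ 2 + q * (sin θ * cos θ) := fun θ => by rw [hrad, add_zero]; ring
    simp_rw [this]
    rw [intervalIntegral.integral_add (Continuous.intervalIntegrable (by fun_prop) _ _)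
      (Continuous.intervalIntegrable (by fun_prop) _ _), intervalIntegral.integral_const_mul,
      intervalIntegral.integral_const_mul, integral_cos_sq, integral_sin_mul_cos₁]
    simp; ring
  have i2 : ∫ θ in (-π)..π, fderiv ℝ v c (radial θ) * cos (θ + -(π / 2)) = π * q := by
    have : ∀ θ, fderiv ℝ v c (radial θ) * cos (θ + -(π / 2)) =
        p * (sin θ * cos θ) + q * sin θ ^ 2 := fun θ => by
      rw [hrad, ← sub_eq_add_neg, cos_sub_pi_div_two]; ring
    simp_rw [this]
    rw [intervalIntegral.integral_add (Continuous.intervalIntegrable (by fun_prop) _ _)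
      (Continuous.intervalIntegrable (by fun_prop) _ _), intervalIntegral.integral_const_mul,
      intervalIntegral.integral_const_mul, integral_sin_sq, integral_sin_mul_cos₁]
    simp; ring
  rw [i1, abs_mul, abs_of_pos pi_pos] at h1
  rw [i2, abs_mul, abs_of_pos pi_pos] at h2
  have hp : |p| ≤ 2 * (A * exp (-t) + K * exp t) := by nlinarith [pi_pos]
  have hq : |q| ≤ 2 * (A * exp (-t) + K * exp t) := by nlinarith [pi_pos]
  exact (norm_le_of_apply_single _ hp hq).trans (by linarith)

end Local

/-! ### Small-energy regularity -/

theorem continuous_comp_polarPt {f : E2 → ℝ} {s : Set E2} (hf : ContinuousOn f s) {c : E2} {t : ℝ}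
    (hmem : ∀ θ, polarPt c t θ ∈ s) : Continuous fun θ => f (polarPt c t θ) :=
  hf.comp_continuous ((continuous_polarPt c).comp (f := fun θ : ℝ => (t, θ)) (by fun_prop)) hmem

theorem continuousOn_circleIntegral {f : E2 → ℝ} {s : Set E2} (hf : ContinuousOn f s) {c : E2}
    {S : Set ℝ} (hmem : ∀ t ∈ S, ∀ θ, polarPt c t θ ∈ s) :
    ContinuousOn (fun t => ∫ θ in (-π)..π, f (polarPt c t θ)) S :=
  continuousOn_integral_period (F := fun t θ => f (polarPt c t θ))
    (hf.comp (continuous_polarPt c).continuousOn fun q hq => hmem q.1 hq.1 q.2)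

/-- A form of Jensen's inequality for the exponential over a period. -/
theorem exp_mul_le_integral_exp {f : ℝ → ℝ} (hf : Continuous f) (k : ℝ) :
    exp k * (2 * π * (1 - k) + ∫ θ in (-π)..π, f θ) ≤ ∫ θ in (-π)..π, exp (f θ) := by
  have h : ∀ θ, exp k * (1 - k + f θ) ≤ exp (f θ) := fun θ => by
    have h1 := add_one_le_exp (f θ - k)
    calc exp k * (1 - k + f θ) ≤ exp k * exp (f θ - k) := by
          gcongr; linarith
      _ = exp (f θ) := by rw [← exp_add]; congr 1; ring
  have h2 := intervalIntegral.integral_mono_on (μ := volume) (a := -π) (b := π)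
    (f := fun θ => exp k * (1 - k + f θ)) (by linarith [pi_pos])
    (Continuous.intervalIntegrable (by fun_prop) _ _)
    (Continuous.intervalIntegrable (continuous_exp.comp hf) _ _) (fun θ _ => h θ)
  refine le_trans (le_of_eq ?_) h2
  rw [intervalIntegral.integral_const_mul, intervalIntegral.integral_add intervalIntegrable_const
    (hf.intervalIntegrable _ _), intervalIntegral.integral_const, smul_eq_mul]
  ring

theorem sq_mul_exp_le_one {Ω : Set E2} (hΩ : IsOpen Ω) {u : E2 → ℝ} (hu : ContDiffOn ℝ 2 u Ω)
    {y : E2} {R : ℝ} (hR : 0 < R) (hball : closedBall y R ⊆ Ω)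
    (hpde : ∀ x ∈ closedBall y R, lap u x + 2 * exp (u x) = 0)
    (hsmall : ∫ x in closedBall y R, exp (u x) < π * exp (-2) / 4) : R ^ 2 * exp (u y) ≤ 1 := by
  by_contra! hcon
  have huc : ContinuousOn u (closedBall y R) := hu.continuousOn.mono hball
  have hec : ContinuousOn (fun x => exp (u x)) (closedBall y R) := continuous_exp.comp_continuousOn huc
  obtain ⟨x₀, hx₀, hmax⟩ := (isCompact_closedBall y R).exists_isMaxOn
    (nonempty_closedBall.2 hR.le) (f := fun x => (R - dist x y) ^ 2 * exp (u x))
    (((by fun_prop : Continuous fun x => (R - dist x y) ^ 2).continuousOn).mul hec)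
  set ρ := (R - dist x₀ y) / 2 with hρ
  set w := exp (u x₀) with hw
  have hw0 : 0 < w := exp_pos _
  have hR0 : dist x₀ y ≤ R := hx₀
  have hmx : ∀ x ∈ closedBall y R, (R - dist x y) ^ 2 * exp (u x) ≤ 4 * ρ ^ 2 * w := by
    intro x hx
    have h : (R - dist x y) ^ 2 * exp (u x) ≤ (R - dist x₀ y) ^ 2 * w := hmax hx
    rwa [show R - dist x₀ y = 2 * ρ by rw [hρ]; ring, mul_pow, show (2 : ℝ) ^ 2 = 4 by norm_num] at h
  have h1 : 1 < 4 * ρ ^ 2 * w := by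
    have := hmx y (mem_closedBall_self hR.le)
    rw [dist_self, sub_zero] at this
    linarith
  have hρ0 : 0 < ρ := by
    have h2 : 0 ≤ ρ := by rw [hρ]; linarith
    rcases h2.lt_or_eq with h | h
    · exact h
    · rw [← h] at h1; norm_num at h1
  have hsub : ball x₀ ρ ⊆ closedBall y R := by
    intro x hx
    have h2 := dist_triangle x x₀ y
    rw [mem_ball] at hx
    rw [mem_closedBall]
    linarith
  have hbd : ∀ x ∈ ball x₀ ρ, exp (u x) ≤ 4 * w := by
    intro x hx
    have h2 := dist_triangle x x₀ y
    have h3 := hmx x (hsub hx)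
    rw [mem_ball] at hx
    have h4 : ρ ^ 2 ≤ (R - dist x y) ^ 2 := by
      apply pow_le_pow_left₀ hρ0.le
      linarith
    have h5 : ρ ^ 2 * exp (u x) ≤ ρ ^ 2 * (4 * w) := by
      nlinarith [mul_le_mul_of_nonneg_right h4 (exp_pos (u x)).le]
    exact le_of_mul_le_mul_left h5 (by positivity)
  have hT : exp (log ρ) = ρ := exp_log hρ0
  set b := -log (4 * w) / 2 with hb
  have hb2 : exp (2 * b) * (4 * w) = 1 := by
    rw [hb, show 2 * (-log (4 * w) / 2) = -log (4 * w) by ring, exp_neg, exp_log (by positivity)]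
    exact inv_mul_cancel₀ (by positivity)
  have e2 : ∀ t : ℝ, exp (2 * t) = exp t ^ 2 := fun t => by rw [← exp_nat_mul]; norm_num
  have hbT : b < log ρ := by
    rw [lt_log_iff_exp_lt hρ0]
    refine lt_of_pow_lt_pow_left₀ 2 hρ0.le ?_
    rw [← e2]
    have : exp (2 * b) * (4 * w) < ρ ^ 2 * (4 * w) := by linarith
    exact lt_of_mul_lt_mul_right this (by positivity)
  have hmem : ∀ t ∈ Set.Iic b, ∀ θ, polarPt x₀ t θ ∈ closedBall y R := fun t ht θ =>
    hsub (by simpa [hT] using polarPt_mem_ball (T := log ρ) x₀ (lt_of_le_of_lt ht hbT) θ)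
  have hlow : ∀ t ∈ Set.Icc (b - 1) b,
      π * exp (-2) / 4 ≤ exp (2 * t) * ∫ θ in (-π)..π, exp (u (polarPt x₀ t θ)) := by
    intro t ht
    have hm := two_pi_mul_sub_le_integral (T := log ρ) (K := 8 * w) hΩ hu
      (by rw [hT]; exact hsub.trans hball)
      (by
        rw [hT]
        intro x hx
        linarith [hpde x (hsub hx), hbd x hx]) (ht.2.trans_lt hbT)
    have hj := exp_mul_le_integral_exp (continuous_comp_polarPt huc (hmem t ht.2)) (u x₀)
    have ht1 : exp (2 * t) ≤ exp (2 * b) := exp_le_exp.2 (by linarith [ht.2])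
    have ht2 : exp (-2) * exp (2 * b) ≤ exp (2 * t) := by
      rw [← exp_add]; exact exp_le_exp.2 (by linarith [ht.1])
    have h6 : π * w ≤ ∫ θ in (-π)..π, exp (u (polarPt x₀ t θ)) := by
      refine le_trans ?_ hj
      rw [mul_comm π w]
      refine mul_le_mul_of_nonneg_left ?_ hw0.le
      have h7 : w * exp (2 * t) ≤ 1 / 4 := by nlinarith
      nlinarith [pi_pos]
    calc π * exp (-2) / 4 = exp (-2) * exp (2 * b) * (π * w) := by
          linear_combination (-π * exp (-2) / 4) * hb2
      _ ≤ _ := by gcongr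
  have hint := intervalIntegral.integral_mono_on (μ := volume) (a := b - 1) (b := b)
    (f := fun _ => π * exp (-2) / 4) (by linarith) intervalIntegrable_const
    (ContinuousOn.intervalIntegrable (by
      rw [Set.uIcc_of_le (by linarith)]
      exact (by fun_prop : Continuous fun t : ℝ => exp (2 * t)).continuousOn.mul
        (continuousOn_circleIntegral hec fun t ht => hmem t ht.2))) hlow
  have htot := integral_log_polar_le (f := fun x => exp (u x)) (fun x => (exp_pos _).le)
    (hec.integrableOn_compact (isCompact_closedBall y R)) hec (by linarith : b - 1 ≤ b)
    (fun t ht θ => hmem t ht.2 θ)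
  rw [intervalIntegral.integral_const, smul_eq_mul] at hint
  linarith

/-! ### A comparison principle for a second-order linear equation -/

theorem nonneg_of_deriv_deriv_le {d d' d'' : ℝ → ℝ} {ν a b : ℝ}
    (hd : ∀ t ∈ Set.Icc a b, HasDerivAt d (d' t) t)
    (hd' : ∀ t ∈ Set.Icc a b, HasDerivAt d' (d'' t) t)
    (hle : ∀ t ∈ Set.Icc a b, d'' t ≤ ν ^ 2 * d t) (ha : 0 ≤ d a) (hb : 0 ≤ d b) {t : ℝ}
    (ht : t ∈ Set.Icc a b) : 0 ≤ d t := by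
  have hE : ∀ (κ t : ℝ), HasDerivAt (fun t => exp (κ * t)) (κ * exp (κ * t)) t := fun κ t => by
    simpa [mul_comm] using ((hasDerivAt_id t).const_mul κ).exp
  have hP : AntitoneOn (fun t => exp (-ν * t) * (d' t + ν * d t)) (Set.Icc a b) := by
    have hder : ∀ t ∈ Set.Icc a b, HasDerivAt (fun t => exp (-ν * t) * (d' t + ν * d t))
        (exp (-ν * t) * (d'' t - ν ^ 2 * d t)) t := fun t ht => by
      refine ((hE (-ν) t).mul ((hd' t ht).add ((hd t ht).const_mul ν))).congr_deriv ?_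
      simp only [Pi.add_apply]
      ring
    refine antitoneOn_of_hasDerivWithinAt_nonpos (convex_Icc a b)
      (fun t ht => (hder t ht).continuousAt.continuousWithinAt)
      (fun t ht => (hder t (interior_subset ht)).hasDerivWithinAt) fun t ht => ?_
    exact mul_nonpos_of_nonneg_of_nonpos (exp_pos _).le
      (by linarith [hle t (interior_subset ht)])
  have hD : ∀ t ∈ Set.Icc a b, HasDerivAt (fun t => exp (ν * t) * d t)
      (exp (ν * t) * (d' t + ν * d t)) t := fun t ht => by
    refine ((hE ν t).mul (hd t ht)).congr_deriv ?_
    ring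
  suffices h : 0 ≤ exp (ν * t) * d t from nonneg_of_mul_nonneg_right h (exp_pos _)
  rcases le_total 0 (d' t + ν * d t) with hs | hs
  · have hsub : Set.Icc a t ⊆ Set.Icc a b := Set.Icc_subset_Icc_right ht.2
    have hm : MonotoneOn (fun t => exp (ν * t) * d t) (Set.Icc a t) := by
      refine monotoneOn_of_hasDerivWithinAt_nonneg (convex_Icc a t)
        (fun s hs => (hD s (hsub hs)).continuousAt.continuousWithinAt)
        (fun s hs => (hD s (hsub (interior_subset hs))).hasDerivWithinAt) fun s hs' => ?_
      have hs' := interior_subset hs'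
      have h1 : exp (-ν * t) * (d' t + ν * d t) ≤ exp (-ν * s) * (d' s + ν * d s) :=
        hP (hsub hs') ht hs'.2
      have h2 := (mul_nonneg (exp_pos (-ν * t)).le hs).trans h1
      exact mul_nonneg (exp_pos _).le (nonneg_of_mul_nonneg_right h2 (exp_pos _))
    exact (mul_nonneg (exp_pos (ν * a)).le ha).trans
      (hm (Set.left_mem_Icc.2 ht.1) (Set.right_mem_Icc.2 ht.1) ht.1)
  · have hsub : Set.Icc t b ⊆ Set.Icc a b := Set.Icc_subset_Icc_left ht.1
    have hm : AntitoneOn (fun t => exp (ν * t) * d t) (Set.Icc t b) := by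
      refine antitoneOn_of_hasDerivWithinAt_nonpos (convex_Icc t b)
        (fun s hs => (hD s (hsub hs)).continuousAt.continuousWithinAt)
        (fun s hs => (hD s (hsub (interior_subset hs))).hasDerivWithinAt) fun s hs' => ?_
      have hs' := interior_subset hs'
      have h1 : exp (-ν * s) * (d' s + ν * d s) ≤ exp (-ν * t) * (d' t + ν * d t) :=
        hP ht (hsub hs') hs'.1
      have h2 := h1.trans (mul_nonpos_of_nonneg_of_nonpos (exp_pos (-ν * t)).le hs)
      exact mul_nonpos_of_nonneg_of_nonpos (exp_pos _).le
        (nonpos_of_mul_nonpos_right h2 (exp_pos _))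
    exact (mul_nonneg (exp_pos (ν * b)).le hb).trans
      (hm (Set.left_mem_Icc.2 ht.2) (Set.right_mem_Icc.2 ht.2) ht.2)

theorem le_of_ode {n : ℕ} (hn : 1 ≤ n) {a a' k : ℝ → ℝ} {t₀ A B K σ : ℝ} (hσ : 0 ≤ σ)
    (hσ' : σ ≤ 1 / 2) (hA : 0 ≤ A)
    (ha : ∀ t ≥ t₀, HasDerivAt a (a' t) t)
    (ha' : ∀ t ≥ t₀, HasDerivAt a' ((n : ℝ) ^ 2 * a t - k t) t)
    (hgrowth : ∀ t ≥ t₀, a t ≤ A + B * (t - t₀))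
    (hk : ∀ t ≥ t₀, |k t| ≤ K * exp (-σ * (t - t₀))) {t : ℝ} (ht : t₀ ≤ t) :
    a t ≤ A * exp (-n * (t - t₀)) + 4 * K / (3 * n ^ 2) * exp (-σ * (t - t₀)) := by
  have hn' : (1 : ℝ) ≤ n := by exact_mod_cast hn
  have hK : 0 ≤ K := by
    have := (abs_nonneg _).trans (hk t₀ le_rfl)
    simpa using this
  set L := 4 * K / (3 * (n : ℝ) ^ 2) with hL
  have hL0 : 0 ≤ L := by positivity
  have hLn : L * n ^ 2 = 4 / 3 * K := by rw [hL]; field_simp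
  have hLσ : L * σ ^ 2 ≤ K / 3 := by
    have h1 : σ ^ 2 ≤ 1 / 4 := by nlinarith
    have h2 : (1 : ℝ) ≤ n ^ 2 := by nlinarith
    nlinarith [mul_le_mul_of_nonneg_left h1 hL0, mul_le_mul_of_nonneg_left h2 hL0]
  have hE : ∀ (κ t : ℝ), HasDerivAt (fun t => exp (κ * (t - t₀))) (κ * exp (κ * (t - t₀))) t :=
    fun κ t => by
      simpa [mul_comm] using (((hasDerivAt_id t).sub_const t₀).const_mul κ).exp
  refine le_of_forall_pos_le_add fun δ hδ => ?_
  set ε := δ * exp (-n * (t - t₀)) with hε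
  have hε0 : 0 < ε := by positivity
  have hεt : ε * exp (n * (t - t₀)) = δ := by
    rw [hε, mul_assoc, ← exp_add]; simp
  set d : ℝ → ℝ := fun t => A * exp (-n * (t - t₀)) + L * exp (-σ * (t - t₀))
    + ε * exp (n * (t - t₀)) - a t with hd
  obtain ⟨T, hT, htT⟩ : ∃ T, A + B * (T - t₀) ≤ ε * exp (n * (T - t₀)) ∧ t ≤ T := by
    have h1 : Tendsto (fun x : ℝ => x / exp x) atTop (𝓝 0) := by
      simpa using tendsto_pow_mul_exp_neg_atTop_nhds_zero 1 |>.congr fun x => by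
        rw [exp_neg, pow_one, div_eq_mul_inv]
    have h2 : Tendsto (fun x : ℝ => (A + B * x) / exp x) atTop (𝓝 0) := by
      have := (tendsto_exp_neg_atTop_nhds_zero.const_mul A).add (h1.const_mul B)
      rw [mul_zero, mul_zero, add_zero] at this
      refine this.congr fun x => ?_
      rw [exp_neg]; field_simp
    obtain ⟨x, hx, hx'⟩ := ((h2.eventually_le_const hε0).and
      (eventually_ge_atTop (max 0 (t - t₀)))).exists
    refine ⟨t₀ + x, ?_, by linarith [le_max_right 0 (t - t₀)]⟩
    rw [add_sub_cancel_left]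
    have hx0 : 0 ≤ x := (le_max_left _ _).trans hx'
    rw [div_le_iff₀ (exp_pos x)] at hx
    refine hx.trans (mul_le_mul_of_nonneg_left (exp_le_exp.2 ?_) hε0.le)
    nlinarith
  have key : 0 ≤ d t := by
    refine nonneg_of_deriv_deriv_le (ν := n) (a := t₀) (b := T)
      (d' := fun t => A * (-n * exp (-n * (t - t₀))) + L * (-σ * exp (-σ * (t - t₀)))
        + ε * (n * exp (n * (t - t₀))) - a' t)
      (d'' := fun t => A * (-n * (-n * exp (-n * (t - t₀)))) + L * (-σ * (-σ * exp (-σ * (t - t₀))))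
        + ε * (n * (n * exp (n * (t - t₀)))) - (n ^ 2 * a t - k t)) ?_ ?_ ?_ ?_ ?_ ⟨ht, htT⟩
    · exact fun s hs => ((((hE (-n) s).const_mul A).add ((hE (-σ) s).const_mul L)).add
        ((hE n s).const_mul ε)).sub (ha s hs.1)
    · exact fun s hs => (((((hE (-n) s).const_mul (-n : ℝ)).const_mul A).add
        (((hE (-σ) s).const_mul (-σ)).const_mul L)).add
        (((hE n s).const_mul (n : ℝ)).const_mul ε)).sub (ha' s hs.1)
    · intro s hs
      have h1 := (abs_le.1 (hk s hs.1)).2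
      have h2 := exp_pos (-σ * (s - t₀))
      simp only [hd]
      nlinarith [mul_le_mul_of_nonneg_right hLσ h2.le, congrArg (· * exp (-σ * (s - t₀))) hLn]
    · have := hgrowth t₀ le_rfl
      simp only [hd, sub_self, mul_zero, exp_zero, mul_one, add_zero] at this ⊢
      linarith
    · have h1 := hgrowth T (ht.trans htT)
      have h2 : 0 ≤ A * exp (-n * (T - t₀)) := by positivity
      have h3 : 0 ≤ L * exp (-σ * (T - t₀)) := by positivity
      simp only [hd]
      linarith
  simp only [hd, hεt] at key
  linarith

theorem abs_le_of_ode {n : ℕ} (hn : 1 ≤ n) {a a' k : ℝ → ℝ} {t₀ A B K σ : ℝ} (hσ : 0 ≤ σ)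
    (hσ' : σ ≤ 1 / 2)
    (ha : ∀ t ≥ t₀, HasDerivAt a (a' t) t)
    (ha' : ∀ t ≥ t₀, HasDerivAt a' ((n : ℝ) ^ 2 * a t - k t) t)
    (hgrowth : ∀ t ≥ t₀, |a t| ≤ A + B * (t - t₀))
    (hk : ∀ t ≥ t₀, |k t| ≤ K * exp (-σ * (t - t₀))) {t : ℝ} (ht : t₀ ≤ t) :
    |a t| ≤ A * exp (-n * (t - t₀)) + 4 * K / (3 * n ^ 2) * exp (-σ * (t - t₀)) := by
  have hA : 0 ≤ A := by simpa using (abs_nonneg _).trans (hgrowth t₀ le_rfl)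
  refine abs_le'.2 ⟨le_of_ode hn hσ hσ' hA ha ha' (fun t ht => (le_abs_self _).trans (hgrowth t ht))
    hk ht, ?_⟩
  refine le_of_ode (a := fun t => -a t) (a' := fun t => -a' t) (k := fun t => -k t) hn hσ hσ' hA
    (fun t ht => (ha t ht).neg) (fun t ht => (ha' t ht).neg.congr_deriv (by ring))
    (fun t ht => (neg_le_abs _).trans (hgrowth t ht)) (fun t ht => by rw [abs_neg]; exact hk t ht) ht

/-! ### Oscillation of a periodic function with decaying Fourier coefficients -/

theorem norm_integral_exp_mul_le {f : ℝ → ℝ} (hf : Continuous f) {B : ℝ} {n : ℕ}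
    (h : ∀ φ, |∫ θ in (-π)..π, f θ * cos (n * θ + φ)| ≤ B) {k : ℤ} (hk : k.natAbs = n) :
    ‖∫ θ in (-π)..π, Complex.exp (-(k * θ) * Complex.I) * (f θ : ℂ)‖ ≤ B := by
  set z := ∫ θ in (-π)..π, Complex.exp (-(k * θ) * Complex.I) * (f θ : ℂ) with hz
  have hre : ‖z‖ = (Complex.exp (-(z.arg * Complex.I)) * z).re := by
    have : Complex.exp (-(z.arg * Complex.I)) * z = (‖z‖ : ℂ) := by
      nth_rewrite 2 [← Complex.norm_mul_exp_arg_mul_I z]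
      rw [mul_left_comm, ← Complex.exp_add, neg_add_cancel, Complex.exp_zero, mul_one]
    rw [this, Complex.ofReal_re]
  have hint : ‖z‖ = ∫ θ in (-π)..π, f θ * cos (k * θ + z.arg) := by
    rw [hre]
    conv_lhs => rw [hz, ← intervalIntegral.integral_const_mul, ← Complex.reCLM_apply]
    rw [← Complex.reCLM.intervalIntegral_comp_comm
      (Continuous.intervalIntegrable (by fun_prop) _ _)]
    refine intervalIntegral.integral_congr fun θ _ => ?_
    have : Complex.exp (-(z.arg * Complex.I)) * (Complex.exp (-(k * θ) * Complex.I) * (f θ : ℂ)) =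
        (f θ : ℂ) * Complex.exp ((-(k * θ + z.arg) : ℝ) * Complex.I) := by
      rw [← mul_assoc, ← Complex.exp_add, mul_comm]
      congr 2
      push_cast
      ring
    simp only [Complex.reCLM_apply]
    rw [this, Complex.re_ofReal_mul, Complex.exp_ofReal_mul_I_re, cos_neg]
  rcases Int.natAbs_eq k with hk' | hk'
  · rw [hint, hk', hk]
    exact (le_abs_self _).trans (by simpa using h z.arg)
  · rw [hint, hk', hk]
    refine (le_abs_self _).trans ?_
    refine (congrArg abs (intervalIntegral.integral_congr fun θ _ => ?_)).trans_le (h (-z.arg))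
    rw [← cos_neg]
    push_cast
    ring_nf

/-- A continuous periodic function whose Fourier coefficients decay quadratically is close to its
mean. -/
theorem abs_sub_mean_le {f : ℝ → ℝ} (hf : Continuous f) (hper : Function.Periodic f (2 * π))
    {C : ℝ}
    (h : ∀ n : ℕ, 1 ≤ n → ∀ φ, |∫ θ in (-π)..π, f θ * cos (n * θ + φ)| ≤ C / (n : ℝ) ^ 2)
    (θ : ℝ) :
    |f θ - (2 * π)⁻¹ * ∫ s in (-π)..π, f s| ≤ (∑' n : ℤ, 1 / (n : ℝ) ^ 2) * C := by
  have : Fact (0 < 2 * π) := ⟨two_pi_pos⟩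
  have hper' : Function.Periodic (fun s => (f s : ℂ)) (2 * π) := fun s => by simp [hper s]
  let F : C(AddCircle (2 * π), ℂ) := ⟨hper'.lift, by
    refine continuous_coinduced_dom.2 ?_
    exact Complex.continuous_ofReal.comp hf⟩
  have hF : ∀ s : ℝ, F s = f s := fun s => rfl
  have hcoef : ∀ n : ℤ, fourierCoeff F n = ((2 * π)⁻¹ : ℝ) •
      ∫ s in (-π)..π, Complex.exp (-(n * s) * Complex.I) * (f s : ℂ) := by
    intro n
    rw [fourierCoeff_eq_intervalIntegral _ _ (-π), one_div, show -π + 2 * π = π by ring]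
    congr 1
    refine intervalIntegral.integral_congr fun s _ => ?_
    rw [hF, fourier_coe_apply, smul_eq_mul]
    congr 2
    have : (π : ℂ) ≠ 0 := by exact_mod_cast pi_ne_zero
    push_cast
    field_simp
  have hsum : Summable fun n : ℤ => 1 / (n : ℝ) ^ 2 := summable_one_div_int_pow.2 one_lt_two
  have h2π : (2 * π)⁻¹ ≤ 1 := inv_le_one_of_one_le₀ (by linarith [pi_gt_three])
  have h2π0 : 0 ≤ (2 * π)⁻¹ := by positivity
  have hbd : ∀ n : ℤ, n ≠ 0 → ‖fourierCoeff F n‖ ≤ 1 / (n : ℝ) ^ 2 * C := by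
    intro n hn
    have := norm_integral_exp_mul_le hf (h n.natAbs (Int.natAbs_pos.2 hn)) rfl
    rw [hcoef, norm_smul, norm_of_nonneg h2π0]
    refine (mul_le_of_le_one_left (norm_nonneg _) h2π).trans (this.trans_eq ?_)
    rw [Nat.cast_natAbs, Int.cast_abs, sq_abs]
    ring
  have hsummable : Summable (fourierCoeff F) := by
    refine Summable.of_norm_bounded_eventually (hsum.mul_right C) ?_
    refine (Set.finite_singleton (0 : ℤ)).subset fun n hn => ?_
    by_contra hn0
    exact hn (hbd n hn0)
  have hs := has_pointwise_sum_fourier_series_of_summable hsummable (θ : AddCircle (2 * π))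
  have h0 : fourierCoeff F 0 • fourier 0 (θ : AddCircle (2 * π)) =
      (((2 * π)⁻¹ * ∫ s in (-π)..π, f s : ℝ) : ℂ) := by
    rw [hcoef]
    simp [intervalIntegral.integral_ofReal]
  have hs' := hs.update 0 0
  rw [h0, hF, zero_sub] at hs'
  have := hs'.norm_le_of_bounded (hsum.mul_right C).hasSum (fun n => ?_)
  · rwa [← Complex.ofReal_neg, ← Complex.ofReal_add, Complex.norm_real, norm_eq_abs,
      neg_add_eq_sub, tsum_mul_right] at this
  · rcases eq_or_ne n 0 with rfl | hn
    · simp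
    · rw [Function.update_of_ne hn, norm_smul]
      refine (mul_le_of_le_one_right (norm_nonneg _) ?_).trans (hbd n hn)
      rw [fourier_apply, Circle.norm_coe]

/-! ### Circle averages of a solution in an exterior domain -/

theorem exists_abs_sub_le_of_hasDerivAt {f f' : ℝ → ℝ} {a K σ : ℝ} (hσ : 0 < σ)
    (hf : ∀ t ≥ a, HasDerivAt f (f' t) t) (hK : ∀ t ≥ a, |f' t| ≤ K * exp (-σ * t)) :
    ∃ c, ∀ t ≥ a, |f t - c| ≤ K / σ * exp (-σ * t) := by
  have hexp : ∀ t, HasDerivAt (fun s => K / σ * exp (-σ * s)) (-(K * exp (-σ * t))) t := fun t => by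
    refine ((((hasDerivAt_id t).const_mul (-σ)).exp).const_mul (K / σ)).congr_deriv ?_
    simp only [id]
    field_simp
  have hanti : AntitoneOn (fun t => f t + K / σ * exp (-σ * t)) (Set.Ici a) := by
    have hd : ∀ t ≥ a, HasDerivAt (fun t => f t + K / σ * exp (-σ * t))
      (f' t + -(K * exp (-σ * t))) t := fun t ht => (hf t ht).fun_add (hexp t)
    refine antitoneOn_of_deriv_nonpos (convex_Ici a)
      (fun t ht => (hd t ht).continuousAt.continuousWithinAt)
      (fun t ht => (hd t (interior_subset ht)).differentiableAt.differentiableWithinAt)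
      fun t ht => ?_
    rw [(hd t (interior_subset ht)).deriv]
    linarith [le_abs_self (f' t), hK t (interior_subset ht)]
  have hmono : MonotoneOn (fun t => f t - K / σ * exp (-σ * t)) (Set.Ici a) := by
    have hd : ∀ t ≥ a, HasDerivAt (fun t => f t - K / σ * exp (-σ * t))
      (f' t - -(K * exp (-σ * t))) t := fun t ht => (hf t ht).fun_sub (hexp t)
    refine monotoneOn_of_deriv_nonneg (convex_Ici a)
      (fun t ht => (hd t ht).continuousAt.continuousWithinAt)
      (fun t ht => (hd t (interior_subset ht)).differentiableAt.differentiableWithinAt)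
      fun t ht => ?_
    rw [(hd t (interior_subset ht)).deriv]
    linarith [neg_abs_le (f' t), hK t (interior_subset ht)]
  have hKσ : 0 ≤ K / σ := by
    have := (abs_nonneg _).trans (hK a le_rfl)
    exact div_nonneg (nonneg_of_mul_nonneg_left this (exp_pos _)) hσ.le
  have hle : ∀ s ≥ a, ∀ t ≥ a, f s - K / σ * exp (-σ * s) ≤ f t + K / σ * exp (-σ * t) := by
    intro s hs t ht
    have h1 := hmono hs (Set.mem_Ici.2 (le_max_of_le_left hs)) (le_max_left s t)
    have h2 := hanti ht (Set.mem_Ici.2 (le_max_of_le_left hs)) (le_max_right s t)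
    have h3 : 0 ≤ K / σ * exp (-σ * max s t) := mul_nonneg hKσ (exp_pos _).le
    simp only at h1 h2
    linarith
  refine ⟨sSup ((fun s => f s - K / σ * exp (-σ * s)) '' Set.Ici a), fun t ht => ?_⟩
  have h1 := le_csSup (a := f t - K / σ * exp (-σ * t))
    (s := (fun s => f s - K / σ * exp (-σ * s)) '' Set.Ici a)
    ⟨f t + K / σ * exp (-σ * t), by rintro _ ⟨s, hs, rfl⟩; exact hle s hs t ht⟩ ⟨t, ht, rfl⟩
  have h2 := csSup_le (s := (fun s => f s - K / σ * exp (-σ * s)) '' Set.Ici a)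
    (Set.nonempty_Ici.image _) (a := f t + K / σ * exp (-σ * t))
    (by rintro _ ⟨s, hs, rfl⟩; exact hle s hs t ht)
  rw [abs_le]
  constructor <;> linarith

theorem exists_sq_mul_exp_le_four {u : E2 → ℝ} {r : ℝ} (hu : ContDiffOn ℝ 2 u {x | r < ‖x‖})
    (hpde : ∀ x : E2, r < ‖x‖ → lap u x + 2 * exp (u x) = 0)
    (hint : Integrable fun x : E2 => exp (u x)) :
    ∃ T, r ≤ exp T ∧ ∀ x : E2, exp T < ‖x‖ → ‖x‖ ^ 2 * exp (u x) ≤ 4 := by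
  have hlim := tendsto_setIntegral_of_antitone (f := fun x : E2 => exp (u x)) (μ := volume)
    (s := fun n : ℕ => {x : E2 | (n : ℝ) < ‖x‖})
    (fun n => (isOpen_lt continuous_const continuous_norm).measurableSet)
    (fun m n hmn x hx => lt_of_le_of_lt (Nat.cast_le.2 hmn) (Set.mem_ofPred_eq ▸ hx))
    ⟨0, hint.integrableOn⟩
  have hempty : ⋂ n : ℕ, {x : E2 | (n : ℝ) < ‖x‖} = ∅ := by
    refine Set.eq_empty_of_forall_notMem fun x hx => ?_
    obtain ⟨n, hn⟩ := exists_nat_ge ‖x‖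
    exact absurd (Set.mem_iInter.1 hx n) (not_lt.2 hn)
  rw [hempty, setIntegral_empty] at hlim
  obtain ⟨N, hN⟩ := (hlim.eventually_lt_const (show 0 < π * exp (-2) / 4 by positivity)).exists
  set R := max (2 * r) (2 * N + 2) with hR
  have hR0 : 0 < R := lt_of_lt_of_le (by positivity) (le_max_right _ _)
  have hRr : 2 * r ≤ R := le_max_left _ _
  have hRN : 2 * N + 2 ≤ R := le_max_right _ _
  refine ⟨log R, ?_, fun y hy => ?_⟩
  · rw [exp_log hR0]; linarith
  rw [exp_log hR0] at hy
  have hsub : ∀ x ∈ closedBall y (‖y‖ / 2), ‖y‖ / 2 ≤ ‖x‖ := fun x hx => by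
    rw [mem_closedBall, dist_eq_norm, norm_sub_rev] at hx
    linarith [norm_sub_norm_le y x]
  have h := sq_mul_exp_le_one (isOpen_lt continuous_const continuous_norm) hu (y := y)
    (R := ‖y‖ / 2) (by linarith) (fun x hx => by
      have := hsub x hx
      exact (by linarith : r < ‖x‖))
    (fun x hx => hpde x (by linarith [hsub x hx]))
    (lt_of_le_of_lt (setIntegral_mono_set hint.integrableOn (ae_of_all _ fun x => (exp_pos _).le)
      (LE.le.eventuallyLE fun x hx => by
        have := hsub x hx
        exact (by linarith : (N : ℝ) < ‖x‖))) hN)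
  nlinarith

section Exterior

variable {u : E2 → ℝ} {T₀ : ℝ}

theorem norm_polarPt_zero (t θ : ℝ) : ‖polarPt 0 t θ‖ = exp t := by
  rw [← norm_polarPt_sub 0 t θ, sub_zero]

theorem polarPt_mem_exterior {t : ℝ} (ht : T₀ < t) (θ : ℝ) :
    polarPt 0 t θ ∈ {x : E2 | exp T₀ < ‖x‖} := by
  rw [Set.mem_ofPred_eq, norm_polarPt_zero]
  exact exp_lt_exp.2 ht

theorem isOpen_exterior : IsOpen {x : E2 | exp T₀ < ‖x‖} :=
  isOpen_lt continuous_const continuous_norm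

theorem continuous_circle (hu : ContDiffOn ℝ 2 u {x | exp T₀ < ‖x‖}) {t : ℝ} (ht : T₀ < t) :
    Continuous fun θ => u (polarPt 0 t θ) :=
  continuous_comp_polarPt hu.continuousOn (polarPt_mem_exterior ht)

theorem hasDerivAt_circleMean (hu : ContDiffOn ℝ 2 u {x | exp T₀ < ‖x‖}) {t : ℝ} (ht : T₀ < t) :
    HasDerivAt (circleCoeff u 0 0 0) (circleCoeffDeriv u 0 0 0 t) t :=
  hasDerivAt_circleCoeff isOpen_exterior hu isOpen_Ioi (fun _ hs => polarPt_mem_exterior hs) 0 0 ht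

theorem circleMean_eq (t : ℝ) : circleCoeff u 0 0 0 t = ∫ θ in (-π)..π, u (polarPt 0 t θ) := by
  simp [circleCoeff]

theorem hasDerivAt_circleFlux (hu : ContDiffOn ℝ 2 u {x | exp T₀ < ‖x‖})
    (hpde : ∀ x : E2, exp T₀ < ‖x‖ → lap u x + 2 * exp (u x) = 0) {t : ℝ} (ht : T₀ < t) :
    HasDerivAt (circleCoeffDeriv u 0 0 0)
      (-2 * (exp (2 * t) * ∫ θ in (-π)..π, exp (u (polarPt 0 t θ)))) t := by
  refine (hasDerivAt_circleCoeffDeriv isOpen_exterior hu isOpen_Ioi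
    (fun _ hs => polarPt_mem_exterior hs) 0 0 ht).congr_deriv ?_
  rw [Nat.cast_zero, zero_pow two_ne_zero, zero_mul, zero_add, mul_left_comm]
  congr 1
  rw [← intervalIntegral.integral_const_mul]
  refine intervalIntegral.integral_congr fun θ _ => ?_
  have := hpde _ (polarPt_mem_exterior ht θ)
  simp only [zero_mul, zero_add, cos_zero, mul_one]
  linarith

theorem circleEnergy_nonneg (t : ℝ) :
    0 ≤ exp (2 * t) * ∫ θ in (-π)..π, exp (u (polarPt 0 t θ)) :=
  mul_nonneg (exp_pos _).le
    (intervalIntegral.integral_nonneg (by linarith [pi_pos]) fun _ _ => (exp_pos _).le)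

theorem antitoneOn_circleFlux (hu : ContDiffOn ℝ 2 u {x | exp T₀ < ‖x‖})
    (hpde : ∀ x : E2, exp T₀ < ‖x‖ → lap u x + 2 * exp (u x) = 0) :
    AntitoneOn (circleCoeffDeriv u 0 0 0) (Set.Ioi T₀) := by
  refine antitoneOn_of_deriv_nonpos (convex_Ioi T₀)
    (fun t ht => (hasDerivAt_circleFlux hu hpde ht).continuousAt.continuousWithinAt)
    (fun t ht => (hasDerivAt_circleFlux hu hpde
      (interior_subset ht)).differentiableAt.differentiableWithinAt) fun t ht => ?_
  rw [(hasDerivAt_circleFlux hu hpde (interior_subset ht)).deriv]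
  linarith [circleEnergy_nonneg (u := u) t]

theorem le_circleFlux (hu : ContDiffOn ℝ 2 u {x | exp T₀ < ‖x‖})
    (hpde : ∀ x : E2, exp T₀ < ‖x‖ → lap u x + 2 * exp (u x) = 0)
    (hint : Integrable fun x : E2 => exp (u x)) {s t : ℝ} (hs : T₀ < s) (hst : s ≤ t) :
    circleCoeffDeriv u 0 0 0 s - 2 * ∫ x, exp (u x) ≤ circleCoeffDeriv u 0 0 0 t := by
  have hc : ContinuousOn (fun x => exp (u x)) {x : E2 | exp T₀ < ‖x‖} :=
    continuous_exp.comp_continuousOn hu.continuousOn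
  have h1 := integral_log_polar_le (c := 0) (fun x => (exp_pos (u x)).le) hint.integrableOn hc hst
    (fun t ht => polarPt_mem_exterior (lt_of_lt_of_le hs ht.1))
  have h2 := setIntegral_le_integral (s := {x : E2 | exp T₀ < ‖x‖}) hint
    (ae_of_all _ fun x => (exp_pos (u x)).le)
  have h3 := intervalIntegral.integral_eq_sub_of_hasDerivAt (a := s) (b := t)
    (fun τ hτ => hasDerivAt_circleFlux hu hpde
      (lt_of_lt_of_le hs (Set.uIcc_of_le hst ▸ hτ).1)) ?_
  · rw [intervalIntegral.integral_const_mul] at h3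
    linarith
  · refine ContinuousOn.intervalIntegrable ?_
    refine continuousOn_const.mul (ContinuousOn.mul (by fun_prop) ?_)
    refine continuousOn_circleIntegral hc fun τ hτ => polarPt_mem_exterior ?_
    exact lt_of_lt_of_le hs (Set.uIcc_of_le hst ▸ hτ).1

theorem tendsto_circleFlux (hu : ContDiffOn ℝ 2 u {x | exp T₀ < ‖x‖})
    (hpde : ∀ x : E2, exp T₀ < ‖x‖ → lap u x + 2 * exp (u x) = 0)
    (hint : Integrable fun x : E2 => exp (u x)) :
    ∃ l, Tendsto (circleCoeffDeriv u 0 0 0) atTop (𝓝 l) ∧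
      ∀ t > T₀, l ≤ circleCoeffDeriv u 0 0 0 t := by
  set g : ℝ → ℝ := fun t => circleCoeffDeriv u 0 0 0 (max t (T₀ + 1))
  have hmem : ∀ t, T₀ < max t (T₀ + 1) := fun t => lt_max_of_lt_right (lt_add_one T₀)
  have hg : Antitone g := fun s t hst =>
    antitoneOn_circleFlux hu hpde (hmem s) (hmem t) (max_le_max_right _ hst)
  have hlim := tendsto_atTop_ciInf hg ⟨_, by
    rintro _ ⟨t, rfl⟩
    exact le_circleFlux hu hpde hint (lt_add_one T₀) (le_max_right t _)⟩
  have hlim' : Tendsto (circleCoeffDeriv u 0 0 0) atTop (𝓝 (⨅ t, g t)) := by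
    refine hlim.congr' ?_
    filter_upwards [eventually_ge_atTop (T₀ + 1)] with t ht
    simp only [g, max_eq_left ht]
  refine ⟨_, hlim', fun t ht => le_of_tendsto hlim' ?_⟩
  filter_upwards [eventually_ge_atTop t] with s hs
  exact antitoneOn_circleFlux hu hpde ht (lt_of_lt_of_le ht hs) hs

theorem circleMean_add_le {l a s t : ℝ} (hu : ContDiffOn ℝ 2 u {x | exp T₀ < ‖x‖})
    (ha : T₀ < a) (hl : ∀ τ ≥ a, l ≤ circleCoeffDeriv u 0 0 0 τ) (hs : a ≤ s) (hst : s ≤ t) :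
    circleCoeff u 0 0 0 s + l * (t - s) ≤ circleCoeff u 0 0 0 t := by
  have h := (convex_Ici a).mul_sub_le_image_sub_of_le_deriv (f := circleCoeff u 0 0 0) (C := l)
    (fun τ hτ => (hasDerivAt_circleMean hu
      (lt_of_lt_of_le ha hτ)).continuousAt.continuousWithinAt)
    (fun τ hτ => (hasDerivAt_circleMean hu
      (lt_of_lt_of_le ha (interior_subset hτ))).differentiableAt.differentiableWithinAt)
    (fun τ hτ => by
      rw [(hasDerivAt_circleMean hu (lt_of_lt_of_le ha (interior_subset hτ))).deriv]
      exact hl τ (interior_subset hτ)) s hs t (hs.trans hst) hst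
  linarith

theorem circleMean_le_add {l a s t : ℝ} (hu : ContDiffOn ℝ 2 u {x | exp T₀ < ‖x‖})
    (ha : T₀ < a) (hl : ∀ τ ≥ a, circleCoeffDeriv u 0 0 0 τ ≤ l) (hs : a ≤ s) (hst : s ≤ t) :
    circleCoeff u 0 0 0 t ≤ circleCoeff u 0 0 0 s + l * (t - s) := by
  have h := (convex_Ici a).image_sub_le_mul_sub_of_deriv_le (f := circleCoeff u 0 0 0) (C := l)
    (fun τ hτ => (hasDerivAt_circleMean hu
      (lt_of_lt_of_le ha hτ)).continuousAt.continuousWithinAt)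
    (fun τ hτ => (hasDerivAt_circleMean hu
      (lt_of_lt_of_le ha (interior_subset hτ))).differentiableAt.differentiableWithinAt)
    (fun τ hτ => by
      rw [(hasDerivAt_circleMean hu (lt_of_lt_of_le ha (interior_subset hτ))).deriv]
      exact hl τ (interior_subset hτ)) s hs t (hs.trans hst) hst
  linarith

theorem le_circleEnergy (hu : ContDiffOn ℝ 2 u {x | exp T₀ < ‖x‖}) {t : ℝ} (ht : T₀ < t) :
    2 * π * exp (2 * t + circleCoeff u 0 0 0 t / (2 * π)) ≤
      exp (2 * t) * ∫ θ in (-π)..π, exp (u (polarPt 0 t θ)) := by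
  have h := exp_mul_le_integral_exp (continuous_circle hu ht) (circleCoeff u 0 0 0 t / (2 * π))
  rw [← circleMean_eq] at h
  rw [exp_add, mul_left_comm]
  gcongr
  refine le_trans (le_of_eq ?_) h
  field_simp
  ring

/-- The limiting flux lies below the critical value `-4π`. -/
theorem limit_circleFlux_lt (hu : ContDiffOn ℝ 2 u {x | exp T₀ < ‖x‖})
    (hpde : ∀ x : E2, exp T₀ < ‖x‖ → lap u x + 2 * exp (u x) = 0) {l : ℝ}
    (hl : ∀ t > T₀, l ≤ circleCoeffDeriv u 0 0 0 t) : l < -(4 * π) := by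
  by_contra! hcon
  set a := T₀ + 1 with ha
  have haT : T₀ < a := lt_add_one T₀
  set q := 2 * π * exp (2 * a + circleCoeff u 0 0 0 a / (2 * π)) with hq
  have hq0 : 0 < q := by positivity
  have hE : ∀ t ≥ a, q ≤ exp (2 * t) * ∫ θ in (-π)..π, exp (u (polarPt 0 t θ)) := by
    intro t ht
    refine le_trans ?_ (le_circleEnergy hu (lt_of_lt_of_le haT ht))
    have h := circleMean_add_le (l := -(4 * π)) hu haT
      (fun τ hτ => hcon.trans (hl τ (lt_of_lt_of_le haT hτ))) le_rfl ht
    rw [hq]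
    gcongr 2 * π * exp ?_
    have h2 : (circleCoeff u 0 0 0 a + -(4 * π) * (t - a)) / (2 * π) ≤
        circleCoeff u 0 0 0 t / (2 * π) := by gcongr
    have h3 : (circleCoeff u 0 0 0 a + -(4 * π) * (t - a)) / (2 * π) =
        circleCoeff u 0 0 0 a / (2 * π) - 2 * (t - a) := by
      field_simp
      ring
    linarith
  have hD : ∀ t ≥ a, circleCoeffDeriv u 0 0 0 t - circleCoeffDeriv u 0 0 0 a ≤
      -2 * q * (t - a) := fun t ht =>
    (convex_Ici a).image_sub_le_mul_sub_of_deriv_le (f := circleCoeffDeriv u 0 0 0)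
      (fun τ hτ => (hasDerivAt_circleFlux hu hpde
        (lt_of_lt_of_le haT hτ)).continuousAt.continuousWithinAt)
      (fun τ hτ => (hasDerivAt_circleFlux hu hpde
        (lt_of_lt_of_le haT (interior_subset hτ))).differentiableAt.differentiableWithinAt)
      (fun τ hτ => by
        rw [(hasDerivAt_circleFlux hu hpde (lt_of_lt_of_le haT (interior_subset hτ))).deriv]
        linarith [hE τ (interior_subset hτ)]) a Set.self_mem_Ici t ht ht
  set d := circleCoeffDeriv u 0 0 0 a with hd
  have hda : l ≤ d := hl a haT
  have ht : a ≤ a + (d - l + 1) / q := by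
    have : 0 ≤ (d - l + 1) / q := div_nonneg (by linarith) hq0.le
    linarith
  have h1 := hD _ ht
  have h2 := hl _ (lt_of_lt_of_le haT ht)
  rw [add_sub_cancel_left, mul_assoc, mul_div_cancel₀ _ hq0.ne'] at h1
  linarith

end Exterior

theorem exp_neg_mul_le {n : ℕ} (hn : 1 ≤ n) {s σ : ℝ} (hs : 1 ≤ s) (hσ' : σ ≤ 1 / 2) :
    exp (-n * s) ≤ 8 / (n : ℝ) ^ 2 * exp (-σ * s) := by
  have hn1 : (1 : ℝ) ≤ n := by exact_mod_cast hn
  have h1 := quadratic_le_exp_of_nonneg (x := (n : ℝ) / 2) (by positivity)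
  have h2 : (n : ℝ) ^ 2 / 8 ≤ exp (n / 2) := by nlinarith
  have h3 : exp (-(n / 2 : ℝ)) ≤ 8 / (n : ℝ) ^ 2 := by
    rw [exp_neg, ← inv_div ((n : ℝ) ^ 2) 8]
    exact inv_anti₀ (by positivity) h2
  calc exp (-n * s) ≤ exp (-(n / 2 : ℝ) + -σ * s) := exp_le_exp.2 (by nlinarith)
    _ = exp (-(n / 2 : ℝ)) * exp (-σ * s) := exp_add _ _
    _ ≤ _ := by gcongr

theorem integral_cos_mul_add {n : ℕ} (hn : 1 ≤ n) (φ : ℝ) :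
    ∫ θ in (-π)..π, cos (n * θ + φ) = 0 := by
  have hn0 : (n : ℝ) ≠ 0 := by positivity
  rw [intervalIntegral.integral_comp_mul_add (fun x => cos x) hn0, integral_cos,
    show (n : ℝ) * π + φ = n * -π + φ + n * (2 * π) by ring, sin_add_nat_mul_two_pi, sub_self,
    smul_zero]

section Exterior

variable {u : E2 → ℝ} {T₀ : ℝ}

theorem abs_circleCoeff_le {L : ℝ} (hu : ContDiffOn ℝ 2 u {x | exp T₀ < ‖x‖}) {t : ℝ} (ht : T₀ < t)
    (hL : ∀ θ, u (polarPt 0 t θ) ≤ L) {n : ℕ} (hn : 1 ≤ n) (φ : ℝ) :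
    |circleCoeff u 0 n φ t| ≤ 2 * π * L - circleCoeff u 0 0 0 t := by
  have hc := continuous_circle hu ht
  have hcos : Continuous fun θ : ℝ => cos (n * θ + φ) := by fun_prop
  have hπ : -π ≤ π := by linarith [pi_pos]
  have h1 : circleCoeff u 0 n φ t = ∫ θ in (-π)..π, (u (polarPt 0 t θ) - L) * cos (n * θ + φ) := by
    simp_rw [sub_mul]
    rw [intervalIntegral.integral_sub ((hc.fun_mul hcos).intervalIntegrable _ _)
      ((hcos.const_mul L).intervalIntegrable _ _), intervalIntegral.integral_const_mul,
      integral_cos_mul_add hn, mul_zero, sub_zero, circleCoeff]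
  have h2 : 2 * π * L - circleCoeff u 0 0 0 t = ∫ θ in (-π)..π, (L - u (polarPt 0 t θ)) := by
    rw [intervalIntegral.integral_sub intervalIntegrable_const (hc.intervalIntegrable _ _),
      circleMean_eq, intervalIntegral.integral_const, smul_eq_mul]
    ring
  rw [h1, h2]
  refine (intervalIntegral.abs_integral_le_integral_abs hπ).trans ?_
  refine intervalIntegral.integral_mono_on (μ := volume) hπ
    (((hc.sub continuous_const).mul hcos).abs.intervalIntegrable _ _)
    ((continuous_const.sub hc).intervalIntegrable _ _) fun θ _ => ?_
  refine abs_mul_cos_le ?_ _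
  rw [abs_sub_comm, abs_of_nonneg (sub_nonneg.2 (hL θ))]

/-- Decay of the nonlinearity yields decay of the oscillation on circles. -/
theorem exists_abs_sub_circleMean_le (hu : ContDiffOn ℝ 2 u {x | exp T₀ < ‖x‖})
    (hpde : ∀ x : E2, exp T₀ < ‖x‖ → lap u x + 2 * exp (u x) = 0) {l : ℝ}
    (hl : ∀ t > T₀, l ≤ circleCoeffDeriv u 0 0 0 t) {a K σ : ℝ} (ha : T₀ < a) (hσ : 0 ≤ σ)
    (hσ' : σ ≤ 1 / 2)
    (hK : ∀ t ≥ a, ∀ θ, exp (2 * t) * exp (u (polarPt 0 t θ)) ≤ K * exp (-σ * (t - a))) :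
    ∃ C, 0 ≤ C ∧ ∀ t ≥ a + 1, ∀ θ,
      |u (polarPt 0 t θ) - (2 * π)⁻¹ * circleCoeff u 0 0 0 t| ≤ C * exp (-σ * (t - a)) := by
  have hT : ∀ t ≥ a, T₀ < t := fun t ht => lt_of_lt_of_le ha ht
  have hK0 : 0 < K := by
    have := (mul_pos (exp_pos (2 * a)) (exp_pos (u (polarPt 0 a 0)))).trans_le (hK a le_rfl 0)
    exact pos_of_mul_pos_left this (exp_pos _).le
  have hupper : ∀ t ≥ a, ∀ θ, u (polarPt 0 t θ) ≤ log K - 2 * t := fun t ht θ => by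
    have h1 : exp (2 * t + u (polarPt 0 t θ)) ≤ K := by
      rw [exp_add]
      refine (hK t ht θ).trans (mul_le_of_le_one_right hK0.le (exp_le_one_iff.2 ?_))
      nlinarith
    linarith [(le_log_iff_exp_le hK0).2 h1]
  set m := circleCoeff u 0 0 0 a with hm
  set A := 2 * π * (log K - 2 * a) - m with hA
  have hA0 : 0 ≤ A := (abs_nonneg _).trans (abs_circleCoeff_le hu ha (hupper a le_rfl) le_rfl 0)
  have hcoef : ∀ n : ℕ, 1 ≤ n → ∀ φ, ∀ t ≥ a, |circleCoeff u 0 n φ t| ≤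
      A * exp (-n * (t - a)) + 4 * (4 * π * K) / (3 * (n : ℝ) ^ 2) * exp (-σ * (t - a)) := by
    intro n hn φ t ht
    refine abs_le_of_ode hn hσ hσ' (B := -(4 * π + l)) (a := circleCoeff u 0 n φ)
      (a' := circleCoeffDeriv u 0 n φ)
      (k := fun t => -(exp (2 * t) * ∫ θ in (-π)..π, lap u (polarPt 0 t θ) * cos (n * θ + φ)))
      (fun t ht => hasDerivAt_circleCoeff isOpen_exterior hu isOpen_Ioi
        (fun _ hs => polarPt_mem_exterior hs) n φ (hT t ht))
      (fun t ht => (hasDerivAt_circleCoeffDeriv isOpen_exterior hu isOpen_Ioi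
        (fun _ hs => polarPt_mem_exterior hs) n φ (hT t ht)).congr_deriv (sub_neg_eq_add _ _).symm)
      (fun t ht => ?_) (fun t ht => ?_) ht
    · have h1 := circleMean_add_le hu ha (fun τ hτ => hl τ (hT τ hτ)) le_rfl ht
      have h2 := abs_circleCoeff_le hu (hT t ht) (hupper t ht) hn φ
      rw [hA]
      nlinarith
    · rw [abs_neg, ← intervalIntegral.integral_const_mul]
      refine (abs_integral_period_le (B := 2 * (K * exp (-σ * (t - a)))) fun θ => ?_).trans_eq
        (by ring)
      rw [← mul_assoc]
      refine abs_mul_cos_le ?_ _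
      have h1 := hpde _ (polarPt_mem_exterior (hT t ht) θ)
      rw [show lap u (polarPt 0 t θ) = -(2 * exp (u (polarPt 0 t θ))) by linarith, mul_neg,
        abs_neg, mul_left_comm, abs_of_nonneg (by positivity)]
      linarith [hK t ht θ]
  set Z := ∑' n : ℤ, 1 / (n : ℝ) ^ 2 with hZ
  have hZ0 : 0 ≤ Z := tsum_nonneg fun n => by positivity
  refine ⟨Z * (8 * A + 16 * π * K / 3), by positivity, fun t ht θ => ?_⟩
  rw [circleMean_eq, mul_assoc]
  have hat : a ≤ t := by linarith
  refine abs_sub_mean_le (continuous_circle hu (hT t hat))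
    ((polarPt_periodic 0 t).comp u) (fun n hn φ => (hcoef n hn φ t hat).trans ?_) θ
  have h1 := exp_neg_mul_le hn (s := t - a) (by linarith) hσ'
  calc _ ≤ A * (8 / (n : ℝ) ^ 2 * exp (-σ * (t - a))) +
        4 * (4 * π * K) / (3 * (n : ℝ) ^ 2) * exp (-σ * (t - a)) := by gcongr
    _ = _ := by
      have : (n : ℝ) ≠ 0 := by positivity
      field_simp
      ring

/-- Logarithmic asymptotics along circles, with the decay of the nonlinearity. -/
theorem exists_asymptotics_polarPt (hu : ContDiffOn ℝ 2 u {x | exp T₀ < ‖x‖})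
    (hpde : ∀ x : E2, exp T₀ < ‖x‖ → lap u x + 2 * exp (u x) = 0)
    (hint : Integrable fun x : E2 => exp (u x))
    (hbd : ∀ x : E2, exp T₀ < ‖x‖ → ‖x‖ ^ 2 * exp (u x) ≤ 4) :
    ∃ α c σ C T : ℝ, 2 < α ∧ 0 < σ ∧ T₀ ≤ T ∧ ∀ t > T, ∀ θ,
      |u (polarPt 0 t θ) + α * t - c| ≤ C * exp (-σ * t) ∧
      exp (2 * t) * exp (u (polarPt 0 t θ)) ≤ C * exp (-σ * t) := by
  obtain ⟨l, hlim, hl⟩ := tendsto_circleFlux hu hpde hint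
  have hl4 := limit_circleFlux_lt hu hpde hl
  obtain ⟨b, hb0, rfl⟩ : ∃ b, 0 < b ∧ l = -(4 * π) - 8 * π * b :=
    ⟨(-(4 * π) - l) / (8 * π), div_pos (by linarith) (by positivity), by field_simp; ring⟩
  have hπb : 0 < π * b := by positivity
  obtain ⟨C₁, hC₁, hosc₁⟩ := exists_abs_sub_circleMean_le hu hpde hl (lt_add_one T₀) le_rfl
    (by norm_num) (K := 4) fun t ht θ => by
      have h := hbd _ (polarPt_mem_exterior (lt_of_lt_of_le (lt_add_one T₀) ht) θ)
      rw [norm_polarPt_zero, ← exp_nat_mul] at h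
      simpa using h
  obtain ⟨a₁, ha₁⟩ := eventually_atTop.1
    (hlim.eventually_le_const (show -(4 * π) - 8 * π * b < -(4 * π) - 4 * π * b by linarith))
  set a := max a₁ (T₀ + 2) with ha
  have haT : T₀ + 2 ≤ a := le_max_right _ _
  have ha0 : T₀ < a := by linarith
  have hmean : ∀ t ≥ a, (2 * π)⁻¹ * circleCoeff u 0 0 0 t ≤
      (2 * π)⁻¹ * circleCoeff u 0 0 0 a - (2 + 2 * b) * (t - a) := fun t ht => by
    have h := circleMean_le_add hu ha0
      (fun τ hτ => ha₁ τ ((le_max_left _ _).trans hτ)) le_rfl ht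
    calc _ ≤ (2 * π)⁻¹ * (circleCoeff u 0 0 0 a + (-(4 * π) - 4 * π * b) * (t - a)) := by gcongr
      _ = _ := by field_simp; ring
  set σ := min (2 * b) (1 / 2) with hσ
  have hσ0 : 0 < σ := lt_min (by linarith) (by norm_num)
  have hσb : σ ≤ 2 * b := min_le_left _ _
  set K := exp ((2 * π)⁻¹ * circleCoeff u 0 0 0 a + C₁ + 2 * a) with hK
  have hdecay : ∀ t ≥ a, ∀ θ, exp (2 * t) * exp (u (polarPt 0 t θ)) ≤
      K * exp (-σ * (t - a)) := fun t ht θ => by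
    rw [← exp_add, hK, ← exp_add]
    refine exp_le_exp.2 ?_
    have h1 := hosc₁ t (by linarith) θ
    rw [neg_zero, zero_mul, exp_zero, mul_one] at h1
    have h2 := (abs_le.1 h1).2
    nlinarith [hmean t ht]
  obtain ⟨C₂, hC₂, hosc₂⟩ := exists_abs_sub_circleMean_le hu hpde hl ha0 hσ0.le
    (min_le_right _ _) hdecay
  have hshift : ∀ t, exp (-σ * (t - a)) = exp (σ * a) * exp (-σ * t) := fun t => by
    rw [← exp_add]; congr 1; ring
  obtain ⟨l', hl'⟩ := exists_abs_sub_le_of_hasDerivAt (a := a) (K := 4 * π * K * exp (σ * a)) hσ0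
    (fun t ht => hasDerivAt_circleFlux hu hpde (lt_of_lt_of_le ha0 ht)) fun t ht => by
      rw [abs_mul, ← intervalIntegral.integral_const_mul, abs_neg, abs_of_pos two_pos]
      have h := abs_integral_period_le (B := K * exp (-σ * (t - a)))
        (f := fun θ => exp (2 * t) * exp (u (polarPt 0 t θ))) fun θ => by
          rw [abs_of_nonneg (by positivity)]; exact hdecay t ht θ
      rw [hshift] at h
      linarith
  have hexp0 : Tendsto (fun t => 4 * π * K * exp (σ * a) / σ * exp (-σ * t)) atTop (𝓝 0) := by
    rw [← mul_zero (4 * π * K * exp (σ * a) / σ)]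
    refine Tendsto.const_mul _ (tendsto_exp_atBot.comp ?_)
    exact tendsto_id.const_mul_atTop_of_neg (neg_lt_zero.2 hσ0)
  have hll : l' = -(4 * π) - 8 * π * b := by
    refine tendsto_nhds_unique ?_ hlim
    rw [← tendsto_sub_nhds_zero_iff]
    refine squeeze_zero_norm' ?_ hexp0
    filter_upwards [eventually_ge_atTop a] with t ht using hl' t ht
  rw [hll] at hl'
  set K' := 4 * π * K * exp (σ * a) / σ with hK'
  obtain ⟨c, hc⟩ := exists_abs_sub_le_of_hasDerivAt (a := a) (K := K') hσ0
    (f := fun t => circleCoeff u 0 0 0 t - (-(4 * π) - 8 * π * b) * t)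
    (f' := fun t => circleCoeffDeriv u 0 0 0 t - (-(4 * π) - 8 * π * b))
    (fun t ht => (hasDerivAt_circleMean hu (lt_of_lt_of_le ha0 ht)).fun_sub
      (by simpa using (hasDerivAt_id t).const_mul (-(4 * π) - 8 * π * b))) hl'
  have hK'0 : 0 ≤ K' := by positivity
  refine ⟨2 + 4 * b, (2 * π)⁻¹ * c, σ, max (C₂ * exp (σ * a) + (2 * π)⁻¹ * (K' / σ))
    (K * exp (σ * a)), a + 1, by linarith, hσ0, by linarith, fun t ht θ => ⟨?_, ?_⟩⟩
  · have h1 := hosc₂ t ht.le θ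
    have h2 := hc t (by linarith)
    rw [hshift] at h1
    have h3 : |(2 * π)⁻¹ * circleCoeff u 0 0 0 t + (2 + 4 * b) * t - (2 * π)⁻¹ * c| ≤
        (2 * π)⁻¹ * (K' / σ * exp (-σ * t)) := by
      rw [show (2 * π)⁻¹ * circleCoeff u 0 0 0 t + (2 + 4 * b) * t - (2 * π)⁻¹ * c =
        (2 * π)⁻¹ * (circleCoeff u 0 0 0 t - (-(4 * π) - 8 * π * b) * t - c) by field_simp; ring,
        abs_mul, abs_of_nonneg (by positivity : 0 ≤ (2 * π)⁻¹)]
      gcongr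
    calc |u (polarPt 0 t θ) + (2 + 4 * b) * t - (2 * π)⁻¹ * c|
        = |(u (polarPt 0 t θ) - (2 * π)⁻¹ * circleCoeff u 0 0 0 t) +
          ((2 * π)⁻¹ * circleCoeff u 0 0 0 t + (2 + 4 * b) * t - (2 * π)⁻¹ * c)| := by
            congr 1; ring
      _ ≤ C₂ * (exp (σ * a) * exp (-σ * t)) + (2 * π)⁻¹ * (K' / σ * exp (-σ * t)) :=
        (abs_add_le _ _).trans (add_le_add h1 h3)
      _ = (C₂ * exp (σ * a) + (2 * π)⁻¹ * (K' / σ)) * exp (-σ * t) := by ring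
      _ ≤ _ := by gcongr; exact le_max_left _ _
  · refine (hdecay t (by linarith) θ).trans ?_
    rw [hshift, ← mul_assoc]
    gcongr
    exact le_max_right _ _

end Exterior

/-! ### Gradient asymptotics -/

theorem hasFDerivAt_log_norm {x : E2} (hx : x ≠ 0) :
    HasFDerivAt (fun y : E2 => log ‖y‖) ((‖x‖ ^ 2)⁻¹ • innerSL ℝ x) x := by
  have hx0 : ‖x‖ ≠ 0 := norm_ne_zero_iff.2 hx
  have h := (((hasStrictFDerivAt_norm_sq x).hasFDerivAt).log (pow_ne_zero 2 hx0)).const_mul (1 / 2)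
  have hfun : (fun y : E2 => log ‖y‖) = fun y : E2 => 1 / 2 * log (‖y‖ ^ 2) := by
    funext y
    rw [log_pow]
    push_cast
    ring
  rw [hfun]
  refine h.congr_fderiv ?_
  ext z
  simp
  ring

theorem contDiffOn_log_norm : ContDiffOn ℝ 2 (fun y : E2 => log ‖y‖) {0}ᶜ := fun _ hx =>
  ((contDiffAt_id.norm ℝ hx).log (norm_ne_zero_iff.2 hx)).contDiffWithinAt

theorem lap_log_norm {x : E2} (hx : x ≠ 0) : lap (fun y : E2 => log ‖y‖) x = 0 := by
  have hx0 : ‖x‖ ^ 2 ≠ 0 := pow_ne_zero 2 (norm_ne_zero_iff.2 hx)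
  have hderiv : ∀ i : Fin 2, fderiv ℝ (fun y => fderiv ℝ (fun y : E2 => log ‖y‖) y
      (EuclideanSpace.single i 1)) x (EuclideanSpace.single i 1) =
      (‖x‖ ^ 2)⁻¹ - 2 * x i ^ 2 * ((‖x‖ ^ 2) ^ 2)⁻¹ := by
    intro i
    have heq : (fun y => fderiv ℝ (fun y : E2 => log ‖y‖) y (EuclideanSpace.single i 1)) =ᶠ[𝓝 x]
        fun y => (‖y‖ ^ 2)⁻¹ * (EuclideanSpace.proj i : E2 →L[ℝ] ℝ) y := by
      filter_upwards [isOpen_compl_singleton.mem_nhds hx] with y hy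
      rw [(hasFDerivAt_log_norm hy).fderiv]
      simp [EuclideanSpace.inner_single_right]
    have h1 := ((hasDerivAt_inv hx0).comp_hasFDerivAt x
      (hasStrictFDerivAt_norm_sq x).hasFDerivAt).fun_mul
      (EuclideanSpace.proj i : E2 →L[ℝ] ℝ).hasFDerivAt
    rw [heq.fderiv_eq]
    refine (DFunLike.congr_fun h1.fderiv _).trans ?_
    simp [EuclideanSpace.inner_single_right]
    ring
  have hsum : x 0 ^ 2 + x 1 ^ 2 = ‖x‖ ^ 2 := by
    simp [EuclideanSpace.norm_sq_eq, Fin.sum_univ_two]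
  rw [lap, Fin.sum_univ_two, hderiv, hderiv]
  field_simp
  linear_combination -2 * hsum

theorem lap_add_const_mul {v w : E2 → ℝ} {Ω : Set E2} (hΩ : IsOpen Ω) (hv : ContDiffOn ℝ 2 v Ω)
    (hw : ContDiffOn ℝ 2 w Ω) (a c : ℝ) {x : E2} (hx : x ∈ Ω) :
    lap (fun y => v y + a * w y - c) x = lap v x + a * lap w x := by
  have hv' : ∀ y ∈ Ω, HasFDerivAt v (fderiv ℝ v y) y := fun y hy =>
    ((hv.differentiableOn two_ne_zero).differentiableAt (hΩ.mem_nhds hy)).hasFDerivAt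
  have hw' : ∀ y ∈ Ω, HasFDerivAt w (fderiv ℝ w y) y := fun y hy =>
    ((hw.differentiableOn two_ne_zero).differentiableAt (hΩ.mem_nhds hy)).hasFDerivAt
  have hv2 := ((contDiffOn_fderiv hΩ hv).differentiableOn one_ne_zero).differentiableAt
    (hΩ.mem_nhds hx)
  have hw2 := ((contDiffOn_fderiv hΩ hw).differentiableOn one_ne_zero).differentiableAt
    (hΩ.mem_nhds hx)
  have heq : fderiv ℝ (fun y => v y + a * w y - c) =ᶠ[𝓝 x]
      fun y => fderiv ℝ v y + a • fderiv ℝ w y := by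
    filter_upwards [hΩ.mem_nhds hx] with y hy
    exact (((hv' y hy).fun_add ((hw' y hy).const_mul a)).sub_const c).fderiv
  have hvw : ContDiffOn ℝ 2 (fun y => v y + a * w y - c) Ω :=
    (hv.add (contDiffOn_const.mul hw)).sub contDiffOn_const
  rw [lap_eq hΩ hvw hx, lap_eq hΩ hv hx, lap_eq hΩ hw hx, heq.fderiv_eq,
    fderiv_fun_add hv2 (hw2.fun_const_smul a), fderiv_fun_const_smul hw2, Finset.mul_sum,
    ← Finset.sum_add_distrib]
  rfl

theorem norm_gradient_add {u : E2 → ℝ} {y : E2} (hu : DifferentiableAt ℝ u y) (hy : y ≠ 0)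
    (α c : ℝ) : ‖gradient u y + (α / ‖y‖ ^ 2) • y‖ =
      ‖fderiv ℝ (fun x => u x + α * log ‖x‖ - c) y‖ := by
  have h := ((hu.hasFDerivAt.fun_add ((hasFDerivAt_log_norm hy).const_mul α)).sub_const c).fderiv
  rw [h, ← (InnerProductSpace.toDual ℝ E2).norm_map, map_add, toDual_gradient, map_smul, smul_smul,
    div_eq_mul_inv]
  rfl

/-- Logarithmic asymptotics, with the gradient, near infinity. -/
theorem exists_asymptotics_of_lt {u : E2 → ℝ} {r : ℝ} (hu : ContDiffOn ℝ 2 u {x | r < ‖x‖})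
    (hpde : ∀ x : E2, r < ‖x‖ → lap u x + 2 * exp (u x) = 0)
    (hint : Integrable fun x : E2 => exp (u x)) :
    ∃ α c σ C R : ℝ, 2 < α ∧ 0 < σ ∧ ∀ y : E2, R < ‖y‖ →
      |u y + α * log ‖y‖ - c| ≤ C * ‖y‖ ^ (-σ) ∧
      ‖gradient u y + (α / ‖y‖ ^ 2) • y‖ ≤ C * ‖y‖ ^ (-σ - 1) := by
  obtain ⟨T₀, hT₀, hbd⟩ := exists_sq_mul_exp_le_four hu hpde hint
  replace hu : ContDiffOn ℝ 2 u {x | exp T₀ < ‖x‖} := hu.mono fun x hx => hT₀.trans_lt hx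
  replace hpde : ∀ x : E2, exp T₀ < ‖x‖ → lap u x + 2 * exp (u x) = 0 :=
    fun x hx => hpde x (hT₀.trans_lt hx)
  obtain ⟨α, c, σ, C, T, hα, hσ, hT, hasymp⟩ := exists_asymptotics_polarPt hu hpde hint hbd
  set v : E2 → ℝ := fun x => u x + α * log ‖x‖ - c with hv
  have hne : ∀ x : E2, exp T₀ < ‖x‖ → x ≠ 0 := fun x hx =>
    norm_ne_zero_iff.1 ((exp_pos T₀).trans hx).ne'
  have hfar : ∀ x : E2, exp T < ‖x‖ → exp T₀ < ‖x‖ := fun x hx => (exp_le_exp.2 hT).trans_lt hx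
  have hlog : ContDiffOn ℝ 2 (fun y : E2 => log ‖y‖) {x | exp T₀ < ‖x‖} :=
    contDiffOn_log_norm.mono fun x hx => hne x hx
  have hvc : ContDiffOn ℝ 2 v {x | exp T₀ < ‖x‖} :=
    (hu.add (contDiffOn_const.mul hlog)).sub contDiffOn_const
  have hpt : ∀ x : E2, exp T < ‖x‖ → |v x| ≤ C * ‖x‖ ^ (-σ) ∧
      |lap v x| ≤ 2 * C * ‖x‖ ^ (-σ - 2) := fun x hx => by
    have hx0 := (exp_pos T).trans hx
    obtain ⟨θ, hθ⟩ := exists_eq_polarPt (hne x (hfar x hx))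
    rw [sub_zero] at hθ
    obtain ⟨h1, h2⟩ := hasymp (log ‖x‖) ((lt_log_iff_exp_lt hx0).2 hx) θ
    have hpow : exp (-σ * log ‖x‖) = ‖x‖ ^ (-σ) := by rw [rpow_def_of_pos hx0, mul_comm]
    have hsq : exp (2 * log ‖x‖) = ‖x‖ ^ (2 : ℝ) := by rw [rpow_def_of_pos hx0, mul_comm]
    rw [← hθ, hpow] at h1 h2
    refine ⟨h1, ?_⟩
    rw [lap_add_const_mul isOpen_exterior hu hlog α c (hfar x hx), lap_log_norm (hne x (hfar x hx)),
      mul_zero, add_zero, show lap u x = -(2 * exp (u x)) by linarith [hpde x (hfar x hx)], abs_neg,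
      abs_of_nonneg (by positivity), rpow_sub hx0, mul_assoc, mul_div_assoc']
    gcongr
    rw [le_div_iff₀ (rpow_pos_of_pos hx0 2), mul_comm, ← hsq]
    exact h2
  have hC : 0 ≤ C := by
    have h := (hasymp (T + 1) (lt_add_one T) 0).2
    exact nonneg_of_mul_nonneg_left ((by positivity : (0 : ℝ) ≤ _).trans h) (exp_pos _)
  set B := (1 / 2 : ℝ) ^ (-σ) with hB
  have hB0 : 0 < B := rpow_pos_of_pos (by norm_num) _
  refine ⟨α, c, σ, max C (24 * C * B), 2 * exp T, hα, hσ, fun y hy => ?_⟩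
  have hy0 : 0 < ‖y‖ := by linarith [exp_pos T]
  have hyT : exp T < ‖y‖ := by linarith [exp_pos T]
  refine ⟨(hpt y hyT).1.trans (by gcongr; exact le_max_left _ _), ?_⟩
  rw [norm_gradient_add ((hu.differentiableOn two_ne_zero).differentiableAt
    (isOpen_exterior.mem_nhds (hfar y hyT))) (hne y (hfar y hyT)) α c]
  have hball : ∀ x ∈ ball y (exp (log (‖y‖ / 2))), ‖y‖ / 2 < ‖x‖ := fun x hx => by
    rw [exp_log (by positivity), mem_ball, dist_eq_norm, norm_sub_rev] at hx
    linarith [norm_sub_norm_le y x]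
  have hhalf : ∀ s : ℝ, s ≤ 0 → ∀ x ∈ ball y (exp (log (‖y‖ / 2))),
      ‖x‖ ^ s ≤ (‖y‖ * (1 / 2)) ^ s := fun s hs x hx =>
    rpow_le_rpow_of_nonpos (by positivity) (by linarith [hball x hx]) hs
  have h := norm_fderiv_le (c := y) (T := log (‖y‖ / 2)) (t := log (‖y‖ / 4)) isOpen_exterior hvc
    (fun x hx => hfar x (by linarith [hball x hx])) (A := C * (‖y‖ * (1 / 2)) ^ (-σ))
    (K := 2 * C * (‖y‖ * (1 / 2)) ^ (-σ - 2))
    (fun x hx => (hpt x (by linarith [hball x hx])).1.trans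
      (mul_le_mul_of_nonneg_left (hhalf _ (by linarith) x hx) hC))
    (fun x hx => (hpt x (by linarith [hball x hx])).2.trans
      (mul_le_mul_of_nonneg_left (hhalf _ (by linarith) x hx) (by positivity)))
    (log_lt_log (by positivity) (by linarith))
  refine h.trans ?_
  rw [exp_neg, exp_log (by positivity), rpow_sub (by positivity) (-σ) 2,
    mul_rpow hy0.le (by norm_num), ← hB, rpow_sub hy0, rpow_one, rpow_two]
  calc _ = 24 * C * B * (‖y‖ ^ (-σ) / ‖y‖) := by field_simp; ring
    _ ≤ _ := by gcongr; exact le_max_right _ _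

/-- A continuous function of the position, compared with a power of the norm, is controlled on a
closed annulus. -/
theorem exists_le_mul_rpow_of_continuousOn {F : E2 → ℝ} {r R s : ℝ} (hr : 0 < r)
    (hF : ContinuousOn F {x | r ≤ ‖x‖}) :
    ∃ C, ∀ y : E2, r ≤ ‖y‖ → ‖y‖ ≤ R → F y ≤ C * ‖y‖ ^ s := by
  have hcpt : IsCompact (closedBall (0 : E2) R ∩ {x | r ≤ ‖x‖}) :=
    (isCompact_closedBall 0 R).inter_right (isClosed_le continuous_const continuous_norm)
  have hpos : ∀ y : E2, r ≤ ‖y‖ → 0 < ‖y‖ := fun y hy => hr.trans_le hy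
  have hG : ContinuousOn (fun y : E2 => F y / ‖y‖ ^ s) (closedBall (0 : E2) R ∩ {x | r ≤ ‖x‖}) :=
    (hF.mono Set.inter_subset_right).div
      (continuous_norm.continuousOn.rpow_const fun y hy => Or.inl (hpos y hy.2).ne')
      fun y hy => (rpow_pos_of_pos (hpos y hy.2) s).ne'
  obtain ⟨C, hC⟩ := hcpt.bddAbove_image hG
  refine ⟨C, fun y hy hyR => ?_⟩
  rw [← div_le_iff₀ (rpow_pos_of_pos (hpos y hy) s)]
  exact hC ⟨y, ⟨mem_closedBall_zero_iff.2 hyR, hy⟩, rfl⟩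

/-- Standard potential analysis: a finite-energy solution of
`Δu + 2eᵘ = 4π Σⱼ γⱼ δ_{pⱼ}` (with all `γⱼ > −1`) satisfies
`u(y) = −α log|y| + c + O(|y|^{−σ})` and `∇u(y) = −α y/|y|² + O(|y|^{−σ−1})` at infinity,
for some `α > 2`, `c ∈ ℝ`, `σ > 0`. -/
theorem singular_liouville_asymptotics
    (m : ℕ) (p : Fin m → E2) (hp : Function.Injective p)
    (γ : Fin m → ℝ) (hγ : ∀ j, -1 < γ j)
    (u : E2 → ℝ)
    (hreg : ContDiffOn ℝ 2 u ((Set.range p)ᶜ))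
    (hpde : ∀ x : E2, x ∉ Set.range p → lap u x + 2 * exp (u x) = 0)
    (hsing : ∀ j, ∃ ε > (0:ℝ), ∃ M : ℝ, ∀ x : E2, x ≠ p j → dist x (p j) < ε →
      |u x - 2 * γ j * Real.log ‖x - p j‖| ≤ M)
    (hint : Integrable (fun x : E2 => exp (u x))) :
    ∃ α : ℝ, 2 < α ∧ ∃ c : ℝ, ∃ σ : ℝ, 0 < σ ∧ ∃ C : ℝ,
      ∀ y : E2, max 1 (2 * ⨆ j, ‖p j‖) < ‖y‖ →
        |u y + α * Real.log ‖y‖ - c| ≤ C * ‖y‖ ^ (-σ) ∧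
        ‖gradient u y + (α / ‖y‖ ^ 2) • y‖ ≤ C * ‖y‖ ^ (-σ - 1) := by
  set R₀ := max 1 (2 * ⨆ j, ‖p j‖) with hR₀
  have h1 : 1 ≤ R₀ := le_max_left _ _
  have hmem : ∀ x : E2, R₀ ≤ ‖x‖ → x ∈ (Set.range p)ᶜ := by
    rintro _ hx ⟨j, rfl⟩
    have h2 := le_ciSup (f := fun j => ‖p j‖) (Set.finite_range _).bddAbove j
    have h3 : 2 * ⨆ j, ‖p j‖ ≤ R₀ := le_max_right _ _
    linarith
  have hopen : IsOpen (Set.range p)ᶜ := (Set.finite_range p).isClosed.isOpen_compl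
  obtain ⟨α, c, σ, C, R, hα, hσ, hfar⟩ := exists_asymptotics_of_lt (r := R₀)
    (hreg.mono fun x hx => hmem x (le_of_lt hx)) (fun x hx => hpde x (hmem x hx.le)) hint
  have hne : ∀ x : E2, R₀ ≤ ‖x‖ → x ≠ 0 := fun x hx =>
    norm_ne_zero_iff.1 (by linarith : 0 < ‖x‖).ne'
  have huc : ContinuousOn u {x | R₀ ≤ ‖x‖} := hreg.continuousOn.mono hmem
  have hgc : ContinuousOn (gradient u) {x | R₀ ≤ ‖x‖} :=
    (InnerProductSpace.toDual ℝ E2).symm.continuous.comp_continuousOn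
      ((contDiffOn_fderiv hopen hreg).continuousOn.mono hmem)
  have hnorm : ContinuousOn (fun x : E2 => ‖x‖) {x | R₀ ≤ ‖x‖} := continuous_norm.continuousOn
  obtain ⟨C₁, hC₁⟩ := exists_le_mul_rpow_of_continuousOn (R := R) (s := -σ)
    (F := fun y => |u y + α * log ‖y‖ - c|) (zero_lt_one.trans_le h1)
    ((huc.add (continuousOn_const.mul
      (hnorm.log fun x hx => norm_ne_zero_iff.2 (hne x hx)))).sub continuousOn_const).abs
  have hcoef : ContinuousOn (fun y : E2 => α / ‖y‖ ^ 2) {x | R₀ ≤ ‖x‖} :=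
    continuousOn_const.div (hnorm.pow 2) fun x hx =>
      pow_ne_zero 2 (norm_ne_zero_iff.2 (hne x hx))
  have hgrad : ContinuousOn (fun y : E2 => gradient u y + (α / ‖y‖ ^ 2) • y) {x | R₀ ≤ ‖x‖} :=
    hgc.fun_add (hcoef.fun_smul continuousOn_id)
  obtain ⟨C₂, hC₂⟩ := exists_le_mul_rpow_of_continuousOn (R := R) (s := -σ - 1)
    (F := fun y => ‖gradient u y + (α / ‖y‖ ^ 2) • y‖) (zero_lt_one.trans_le h1)
    hgrad.norm
  refine ⟨α, hα, c, σ, hσ, max C (max C₁ C₂), fun y hy => ?_⟩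
  rcases lt_or_ge R ‖y‖ with h | h
  · exact ⟨(hfar y h).1.trans (by gcongr; exact le_max_left _ _),
      (hfar y h).2.trans (by gcongr; exact le_max_left _ _)⟩
  · exact ⟨(hC₁ y hy.le h).trans (by gcongr; exact le_max_of_le_right (le_max_left _ _)),
      (hC₂ y hy.le h).trans (by gcongr; exact le_max_of_le_right (le_max_right _ _))⟩
end
end

section
/- Let p₁, p₂ be distinct points in ℝ² and θ₁, θ₂ > 0. Let u solve the singular Liouville equation Δu + 2e^u = 4π(θ₁−1)δ_{p₁} + 4π(θ₂−1)δ_{p₂} in the classical sense (u is C² on ℝ² ∖ {p₁, p₂}, Δu + 2e^u = 0 there, and for each i the function x ↦ u(x) − 2(θᵢ−1)log|x−pᵢ| is bounded near pᵢ), with ∫_{ℝ²} e^u < ∞. Suppose in addition there exist α > 2, c ∈ ℝ, σ > 0 and C > 0 such that for |y| large, |u(y) + α log|y| − c| ≤ C|y|^{−σ} and |∇u(y) + α y/|y|²| ≤ C|y|^{−σ−1}. Then (1/(2π)) ∫_{ℝ²} e^u = θ₁ + θ₂ + α/2 − 2; equivalently, setting θ₃ = α/2 − 1 > 0, one has (1/(2π))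 ∫_{ℝ²} e^u = θ₁ + θ₂ + θ₃ − 1. -/
noncomputable section
open Real MeasureTheory Metric Filter Topology

/-- A smooth step, equal to `0` for `s ≤ 1` and to `1` for `s ≥ 2`. -/
def step (s : ℝ) : ℝ := Real.smoothTransition (s - 1)

lemma step_eq_zero {s : ℝ} (h : s ≤ 1) : step s = 0 :=
  Real.smoothTransition.zero_of_nonpos (by linarith)

lemma step_eq_one {s : ℝ} (h : 2 ≤ s) : step s = 1 :=
  Real.smoothTransition.one_of_one_le (by linarith)

lemma abs_step_le_one (s : ℝ) : |step s| ≤ 1 := by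
  rw [step, abs_of_nonneg (Real.smoothTransition.nonneg _)]
  exact Real.smoothTransition.le_one _

lemma contDiff_step {n : ℕ∞} : ContDiff ℝ n step :=
  Real.smoothTransition.contDiff.comp (contDiff_id.sub contDiff_const)

lemma contDiff_deriv_step {n : ℕ} : ContDiff ℝ n (deriv step) := by
  have h : ContDiff ℝ ((n + 1 : ℕ) : ℕ∞) step := contDiff_step
  have h' : ContDiff ℝ ((n : WithTop ℕ∞) + 1) step := by exact_mod_cast h
  exact h'.deriv'

lemma continuous_deriv_deriv_step : Continuous (deriv (deriv step)) :=
  (contDiff_deriv_step (n := 1)).continuous_deriv (by norm_num)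

lemma hasDerivAt_step (s : ℝ) : HasDerivAt step (deriv step s) s :=
  ((contDiff_step (n := 1)).differentiable (by norm_num) s).hasDerivAt

lemma hasDerivAt_deriv_step (s : ℝ) : HasDerivAt (deriv step) (deriv (deriv step) s) s :=
  ((contDiff_deriv_step (n := 1)).differentiable (by norm_num) s).hasDerivAt

lemma deriv_step_eq_zero {s : ℝ} (h : s < 1 ∨ 2 < s) : deriv step s = 0 := by
  rcases h with h | h
  · have : step =ᶠ[𝓝 s] fun _ => 0 := by
      filter_upwards [Iio_mem_nhds h] with t ht using step_eq_zero (le_of_lt ht)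
    rw [this.deriv_eq, deriv_const]
  · have : step =ᶠ[𝓝 s] fun _ => 1 := by
      filter_upwards [Ioi_mem_nhds h] with t ht using step_eq_one (le_of_lt ht)
    rw [this.deriv_eq, deriv_const]

lemma deriv_deriv_step_eq_zero {s : ℝ} (h : s < 1 ∨ 2 < s) : deriv (deriv step) s = 0 := by
  have : deriv step =ᶠ[𝓝 s] fun _ => 0 := by
    rcases h with h | h
    · filter_upwards [Iio_mem_nhds h] with t ht using deriv_step_eq_zero (.inl ht)
    · filter_upwards [Ioi_mem_nhds h] with t ht using deriv_step_eq_zero (.inr ht)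
  rw [this.deriv_eq, deriv_const]

lemma hasCompactSupport_deriv_deriv_step : HasCompactSupport (deriv (deriv step)) := by
  refine HasCompactSupport.intro (isCompact_Icc (a := (1 : ℝ)) (b := 2)) fun s hs => ?_
  refine deriv_deriv_step_eq_zero ?_
  by_contra! h
  exact hs ⟨h.1, h.2⟩

lemma integral_mul_deriv_deriv_step : ∫ s, s * deriv (deriv step) s = -1 := by
  have hint : Integrable fun s => s * deriv (deriv step) s :=
    (continuous_id.mul continuous_deriv_deriv_step).integrable_of_hasCompactSupport
      hasCompactSupport_deriv_deriv_step.mul_left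
  have hderiv (s : ℝ) :
      HasDerivAt (fun s => s * deriv step s - step s) (s * deriv (deriv step) s) s := by
    refine (((hasDerivAt_id' s).mul (hasDerivAt_deriv_step s)).sub
      (hasDerivAt_step s)).congr_deriv ?_
    ring
  rw [integral_of_hasDerivAt_of_tendsto (m := 0) (n := -1) hderiv hint, sub_zero]
  · refine tendsto_const_nhds.congr' ?_
    filter_upwards [Iio_mem_atBot (1 : ℝ)] with s hs
    rw [deriv_step_eq_zero (.inl hs), step_eq_zero (le_of_lt hs)]; ring
  · refine tendsto_const_nhds.congr' ?_
    filter_upwards [Ioi_mem_atTop (2 : ℝ)] with s hs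
    rw [deriv_step_eq_zero (.inr hs), step_eq_one (le_of_lt hs)]; ring

/-- Integration in logarithmic polar coordinates. -/
lemma integral_log_norm_sub (p : E2) (F : ℝ → ℝ) :
    ∫ x : E2, (‖x - p‖ ^ 2)⁻¹ * F (Real.log ‖x - p‖) = 2 * π * ∫ t, F t := by
  have hexp := integral_image_eq_integral_abs_deriv_smul (s := Set.univ) (f := Real.exp)
    (f' := Real.exp) MeasurableSet.univ (fun x _ => (Real.hasDerivAt_exp x).hasDerivWithinAt)
    Real.exp_injective.injOn fun y => y⁻¹ * F (Real.log y)
  rw [Set.image_univ, Real.range_exp] at hexp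
  rw [integral_sub_right_eq_self (fun x : E2 => (‖x‖ ^ 2)⁻¹ * F (Real.log ‖x‖)) p,
    integral_fun_norm_addHaar volume (fun r => (r ^ 2)⁻¹ * F (Real.log r)), Measure.real,
    EuclideanSpace.volume_ball_fin_two]
  have h : ∫ y in Set.Ioi (0 : ℝ), y ^ (Module.finrank ℝ E2 - 1) • ((y ^ 2)⁻¹ * F (Real.log y))
      = ∫ y in Set.Ioi (0 : ℝ), y⁻¹ * F (Real.log y) := by
    refine setIntegral_congr_fun measurableSet_Ioi fun y hy => ?_
    have hy : 0 < y := hy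
    simp only [finrank_euclideanSpace, Fintype.card_fin, smul_eq_mul]
    field_simp
    simp
  rw [h, hexp]
  simp [abs_of_pos (Real.exp_pos _), mul_assoc, ENNReal.toReal_ofReal Real.pi_pos.le]

lemma integrable_log_norm_sub (p : E2) {F : ℝ → ℝ} (hF : Integrable F) :
    Integrable fun x : E2 => (‖x - p‖ ^ 2)⁻¹ * F (Real.log ‖x - p‖) := by
  have hexp := integrableOn_image_iff_integrableOn_abs_deriv_smul (s := Set.univ) (f := Real.exp)
    (f' := Real.exp) MeasurableSet.univ (fun x _ => (Real.hasDerivAt_exp x).hasDerivWithinAt)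
    Real.exp_injective.injOn fun y => y⁻¹ * F (Real.log y)
  rw [Set.image_univ, Real.range_exp] at hexp
  refine Integrable.comp_sub_right (f := fun x : E2 => (‖x‖ ^ 2)⁻¹ * F (Real.log ‖x‖)) ?_ p
  rw [integrable_fun_norm_addHaar volume (f := fun r => (r ^ 2)⁻¹ * F (Real.log r))]
  have h : Set.EqOn (fun y : ℝ => y ^ (Module.finrank ℝ E2 - 1) • ((y ^ 2)⁻¹ * F (Real.log y)))
      (fun y => y⁻¹ * F (Real.log y)) (Set.Ioi 0) := by
    intro y hy
    have hy : 0 < y := hy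
    simp only [finrank_euclideanSpace, Fintype.card_fin, smul_eq_mul]
    field_simp
    simp
  rw [integrableOn_congr_fun h measurableSet_Ioi, hexp]
  simpa [abs_of_pos (Real.exp_pos _)] using hF

/-- The logarithmic cutoff centred at `p`, with scale `κ`. -/
def logCutoff (κ : ℝ) (p x : E2) : ℝ := step (κ * Real.log ‖x - p‖)

/-- The Laplacian of `logCutoff κ p`. -/
def logCutoffLap (κ : ℝ) (p x : E2) : ℝ :=
  (‖x - p‖ ^ 2)⁻¹ * (κ ^ 2 * deriv (deriv step) (κ * Real.log ‖x - p‖))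

lemma integrable_logCutoffLap {κ : ℝ} (hκ : κ ≠ 0) (p : E2) :
    Integrable (logCutoffLap κ p) := by
  refine integrable_log_norm_sub p (F := fun t => κ ^ 2 * deriv (deriv step) (κ * t)) ?_
  exact ((continuous_deriv_deriv_step.integrable_of_hasCompactSupport
    hasCompactSupport_deriv_deriv_step).comp_mul_left' hκ).const_mul _

lemma integrable_log_mul_logCutoffLap {κ : ℝ} (hκ : κ ≠ 0) (p : E2) :
    Integrable fun x => Real.log ‖x - p‖ * logCutoffLap κ p x := by
  have h := integrable_log_norm_sub p
    (F := fun t => κ * ((κ * t) * deriv (deriv step) (κ * t))) ?_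
  · refine h.congr (.of_forall fun x => ?_)
    simp only [logCutoffLap]; ring
  · have hint : Integrable fun s => s * deriv (deriv step) s :=
      (continuous_id.mul continuous_deriv_deriv_step).integrable_of_hasCompactSupport
        hasCompactSupport_deriv_deriv_step.mul_left
    exact (hint.comp_mul_left' hκ).const_mul _

lemma integral_abs_logCutoffLap {κ : ℝ} (hκ : κ ≠ 0) (p : E2) :
    ∫ x, |logCutoffLap κ p x| = |κ| * (2 * π * ∫ s, |deriv (deriv step) s|) := by
  have h := integral_log_norm_sub p (fun t => κ ^ 2 * |deriv (deriv step) (κ * t)|)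
  have h2 := Measure.integral_comp_mul_left (fun s => |deriv (deriv step) s|) κ
  rw [integral_const_mul, h2, smul_eq_mul] at h
  calc _ = _ := integral_congr_ae (.of_forall fun x => by
        simp only [logCutoffLap, abs_mul, abs_inv, abs_pow, abs_norm, sq_abs])
    _ = _ := h
    _ = _ := by
      rw [← sq_abs, abs_inv]
      have := abs_ne_zero.2 hκ
      field_simp

lemma integral_log_mul_logCutoffLap {κ : ℝ} (hκ : κ ≠ 0) (p : E2) :
    ∫ x, Real.log ‖x - p‖ * logCutoffLap κ p x = -(2 * π * SignType.sign κ) := by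
  have h := integral_log_norm_sub p (fun t => κ * ((κ * t) * deriv (deriv step) (κ * t)))
  have h2 := Measure.integral_comp_mul_left (fun s => s * deriv (deriv step) s) κ
  rw [integral_const_mul, h2, smul_eq_mul, integral_mul_deriv_deriv_step] at h
  calc _ = _ := integral_congr_ae (.of_forall fun x => by simp only [logCutoffLap]; ring)
    _ = _ := h
    _ = _ := by
      rcases lt_or_gt_of_ne hκ with h | h
      · rw [abs_of_neg (inv_lt_zero.2 h), sign_neg h]; simp; field_simp
      · rw [abs_of_pos (inv_pos.2 h), sign_pos h]; simp; field_simp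

lemma contDiffAt_logCutoff {κ : ℝ} {p x : E2} (hx : x ≠ p) :
    ContDiffAt ℝ 2 (logCutoff κ p) x := by
  have h : ‖x - p‖ ≠ 0 := norm_ne_zero_iff.2 (sub_ne_zero.2 hx)
  exact (contDiff_step (n := 2)).contDiffAt.comp x (contDiffAt_const.mul
    (((contDiffAt_id.sub contDiffAt_const).norm ℝ (sub_ne_zero.2 hx)).log h))

lemma hasFDerivAt_log_norm_sub {p x : E2} (hx : x ≠ p) :
    HasFDerivAt (fun y : E2 => Real.log ‖y - p‖)
      ((‖x - p‖ ^ 2)⁻¹ • innerSL ℝ (x - p)) x := by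
  have h : ‖x - p‖ ^ 2 ≠ 0 := pow_ne_zero 2 (norm_ne_zero_iff.2 (sub_ne_zero.2 hx))
  have h1 := (((hasFDerivAt_id x).sub_const p).norm_sq.log h).const_mul (1 / 2 : ℝ)
  refine (h1.congr_of_eventuallyEq (.of_forall fun y => ?_)).congr_fderiv ?_
  · simp [Real.log_pow]
  · ext v
    simp
    ring

lemma fderiv_logCutoff {κ : ℝ} {p x : E2} (hx : x ≠ p) (i : Fin 2) :
    fderiv ℝ (logCutoff κ p) x (EuclideanSpace.single i 1) =
      deriv step (κ * Real.log ‖x - p‖) * (κ * ((‖x - p‖ ^ 2)⁻¹ * (x i - p i))) := by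
  have h := (hasDerivAt_step _).comp_hasFDerivAt x ((hasFDerivAt_log_norm_sub hx).const_mul κ)
  have h' : HasFDerivAt (logCutoff κ p) _ x := h
  rw [h'.fderiv]
  simp [EuclideanSpace.inner_single_right]

lemma lap_logCutoff {κ : ℝ} {p x : E2} (hx : x ≠ p) :
    lap (logCutoff κ p) x = logCutoffLap κ p x := by
  have h0 : ‖x - p‖ ^ 2 ≠ 0 := pow_ne_zero 2 (norm_ne_zero_iff.2 (sub_ne_zero.2 hx))
  have key (i : Fin 2) : fderiv ℝ
      (fun y => fderiv ℝ (logCutoff κ p) y (EuclideanSpace.single i 1)) x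
        (EuclideanSpace.single i 1) =
      deriv (deriv step) (κ * Real.log ‖x - p‖) * (κ * ((‖x - p‖ ^ 2)⁻¹ * (x i - p i))) ^ 2 +
      deriv step (κ * Real.log ‖x - p‖) * (κ * ((‖x - p‖ ^ 2)⁻¹ -
        2 * (x i - p i) ^ 2 * ((‖x - p‖ ^ 2)⁻¹) ^ 2)) := by
    have heq : (fun y => fderiv ℝ (logCutoff κ p) y (EuclideanSpace.single i 1)) =ᶠ[𝓝 x]
        fun y => deriv step (κ * Real.log ‖y - p‖) *
          (κ * ((‖y - p‖ ^ 2)⁻¹ * (y i - p i))) := by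
      filter_upwards [isOpen_ne.mem_nhds hx] with y hy using fderiv_logCutoff hy i
    rw [heq.fderiv_eq]
    have h1 : HasFDerivAt (fun y : E2 => deriv step (κ * Real.log ‖y - p‖)) _ x :=
      (hasDerivAt_deriv_step _).comp_hasFDerivAt x ((hasFDerivAt_log_norm_sub hx).const_mul κ)
    have h2 : HasFDerivAt (fun y : E2 => (‖y - p‖ ^ 2)⁻¹) _ x :=
      (hasDerivAt_inv h0).comp_hasFDerivAt x ((hasFDerivAt_id x).sub_const p).norm_sq
    have h3 : HasFDerivAt (fun y : E2 => y i - p i) _ x :=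
      ((EuclideanSpace.proj i : E2 →L[ℝ] ℝ).hasFDerivAt (x := x)).sub_const (p i)
    have h4 : HasFDerivAt (fun y : E2 => deriv step (κ * Real.log ‖y - p‖) *
        (κ * ((‖y - p‖ ^ 2)⁻¹ * (y i - p i)))) _ x := h1.mul ((h2.mul h3).const_mul κ)
    rw [h4.fderiv]
    simp [EuclideanSpace.inner_single_right]
    field_simp
    ring
  have hn : ‖x - p‖ ^ 2 = (x 0 - p 0) ^ 2 + (x 1 - p 1) ^ 2 := by
    simp [EuclideanSpace.norm_sq_eq, Fin.sum_univ_two]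
  simp only [lap, key, Fin.sum_univ_two, logCutoffLap]
  rw [hn] at h0
  generalize deriv (deriv step) (κ * Real.log ‖x - p‖) = a
  generalize deriv step (κ * Real.log ‖x - p‖) = b
  rw [hn]
  field_simp
  ring

lemma logCutoff_eventuallyEq_zero {κ : ℝ} (hκ : 0 < κ) (p : E2) :
    logCutoff κ p =ᶠ[𝓝 p] fun _ => 0 := by
  filter_upwards [ball_mem_nhds p one_pos] with x hx
  rw [mem_ball, dist_eq_norm] at hx
  exact step_eq_zero ((mul_nonpos_of_nonneg_of_nonpos hκ.le
    (Real.log_nonpos (norm_nonneg _) hx.le)).trans zero_le_one)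

lemma contDiff_logCutoff {κ : ℝ} (hκ : 0 < κ) (p : E2) : ContDiff ℝ 2 (logCutoff κ p) := by
  refine contDiff_iff_contDiffAt.2 fun x => ?_
  rcases eq_or_ne x p with rfl | hx
  · exact ContDiffAt.congr_of_eventuallyEq contDiffAt_const (logCutoff_eventuallyEq_zero hκ x)
  · exact contDiffAt_logCutoff hx

lemma lap_congr {f g : E2 → ℝ} {x : E2} (h : f =ᶠ[𝓝 x] g) : lap f x = lap g x := by
  refine Finset.sum_congr rfl fun i _ => ?_
  have : (fun y => fderiv ℝ f y (EuclideanSpace.single i 1)) =ᶠ[𝓝 x]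
      fun y => fderiv ℝ g y (EuclideanSpace.single i 1) := by
    filter_upwards [h.fderiv (𝕜 := ℝ)] with y hy
    rw [hy]
  rw [this.fderiv_eq]

lemma lap_const (c : ℝ) (x : E2) : lap (fun _ => c) x = 0 := by
  simp [lap]

lemma lap_logCutoff_of_pos {κ : ℝ} (hκ : 0 < κ) (p x : E2) :
    lap (logCutoff κ p) x = logCutoffLap κ p x := by
  rcases eq_or_ne x p with rfl | hx
  · rw [lap_congr (logCutoff_eventuallyEq_zero hκ x), lap_const]
    simp [logCutoffLap]
  · exact lap_logCutoff hx

lemma differentiableAt_fderiv_apply {f : E2 → ℝ} {x : E2} (hf : ContDiffAt ℝ 2 f x) (v : E2) :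
    DifferentiableAt ℝ (fun y => fderiv ℝ f y v) x :=
  ((hf.fderiv_right (m := 1) (by norm_num)).differentiableAt (by norm_num)).clm_apply
    (differentiableAt_const v)

lemma lap_sub {f g : E2 → ℝ} {x : E2} (hf : ContDiffAt ℝ 2 f x) (hg : ContDiffAt ℝ 2 g x) :
    lap (fun y => f y - g y) x = lap f x - lap g x := by
  rw [lap, lap, lap, ← Finset.sum_sub_distrib]
  refine Finset.sum_congr rfl fun i _ => ?_
  have : (fun y => fderiv ℝ (fun y => f y - g y) y (EuclideanSpace.single i 1)) =ᶠ[𝓝 x]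
      fun y => fderiv ℝ f y (EuclideanSpace.single i 1) -
        fderiv ℝ g y (EuclideanSpace.single i 1) := by
    filter_upwards [hf.eventually (by simp), hg.eventually (by simp)] with y hfy hgy
    rw [fderiv_fun_sub (hfy.differentiableAt (by norm_num))
      (hgy.differentiableAt (by norm_num))]
    rfl
  rw [this.fderiv_eq, fderiv_fun_sub (differentiableAt_fderiv_apply hf _)
    (differentiableAt_fderiv_apply hg _)]
  rfl

/-- The integral of a directional derivative of a `C¹` function on an open set vanishing outside
a compact subset is zero. -/
lemma setIntegral_fderiv_eq_zero {S K : Set E2} (hS : IsOpen S) (hK : IsCompact K) (hKS : K ⊆ S)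
    {w : E2 → ℝ} (hw : ContDiffOn ℝ 1 w S) (hw0 : ∀ x ∈ S, x ∉ K → w x = 0) (v : E2) :
    IntegrableOn (fun x => fderiv ℝ w x v) S ∧ ∫ x in S, fderiv ℝ w x v = 0 := by
  set W : E2 → ℝ := S.indicator w
  have hWS {x : E2} (hx : x ∈ S) : W =ᶠ[𝓝 x] w := by
    filter_upwards [hS.mem_nhds hx] with y hy using Set.indicator_of_mem hy w
  have hW0 {x : E2} (hx : x ∉ K) : W x = 0 := by
    by_cases hxS : x ∈ S
    · simp [W, hxS, hw0 x hxS hx]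
    · simp [W, hxS]
  have hW : ContDiff ℝ 1 W := by
    refine contDiff_iff_contDiffAt.2 fun x => ?_
    by_cases hx : x ∈ S
    · exact (hw.contDiffAt (hS.mem_nhds hx)).congr_of_eventuallyEq (hWS hx)
    · refine contDiffAt_const (c := (0 : ℝ)).congr_of_eventuallyEq ?_
      filter_upwards [hK.isClosed.isOpen_compl.mem_nhds fun h => hx (hKS h)] with y hy
        using hW0 hy
  have hWc : HasCompactSupport W := HasCompactSupport.intro hK fun x hx => hW0 hx
  have hW'c : Continuous fun x => fderiv ℝ W x v :=
    (hW.continuous_fderiv (by norm_num)).clm_apply continuous_const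
  have hW'int : Integrable fun x => fderiv ℝ W x v :=
    hW'c.integrable_of_hasCompactSupport (hWc.fderiv_apply ℝ v)
  have hzero : ∫ x, fderiv ℝ W x v = 0 := by
    have h := integral_mul_fderiv_eq_neg_fderiv_mul_of_integrable (μ := volume)
      (f := fun _ : E2 => (1 : ℝ)) (g := W) (v := v) (by simp) (by simpa using hW'int)
      (by simpa using hW.continuous.integrable_of_hasCompactSupport hWc)
      (fun x _ => differentiableAt_const _) (fun x _ => hW.differentiable (by norm_num) x)
    simpa using h
  have hcongr : Set.EqOn (fun x => fderiv ℝ W x v) (fun x => fderiv ℝ w x v) S := fun x hx => by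
    simp only [(hWS hx).fderiv_eq]
  refine ⟨hW'int.integrableOn.congr_fun hcongr hS.measurableSet, ?_⟩
  rw [← setIntegral_congr_fun hS.measurableSet hcongr, ← hzero]
  refine setIntegral_eq_integral_of_forall_compl_eq_zero fun x hx => ?_
  have : W =ᶠ[𝓝 x] fun _ => 0 := by
    filter_upwards [hK.isClosed.isOpen_compl.mem_nhds fun h => hx (hKS h)] with y hy using hW0 hy
  simp [this.fderiv_eq]

/-- Green's second identity without boundary terms. -/
lemma setIntegral_green {S K : Set E2} (hS : IsOpen S) (hK : IsCompact K) (hKS : K ⊆ S)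
    {u φ : E2 → ℝ} (hu : ContDiffOn ℝ 2 u S) (hφ : ContDiffOn ℝ 2 φ S)
    (hφ0 : ∀ x ∈ S, x ∉ K → φ x = 0) :
    ∫ x in S, (u x * lap φ x - φ x * lap u x) = 0 := by
  have hd {f : E2 → ℝ} (hf : ContDiffOn ℝ 2 f S) (v : E2) :
      ContDiffOn ℝ 1 (fun y => fderiv ℝ f y v) S :=
    (hf.fderiv_of_isOpen hS (by norm_num)).clm_apply contDiffOn_const
  have hφ0' (v : E2) : ∀ x ∈ S, x ∉ K → fderiv ℝ φ x v = 0 := fun x hx hxK => by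
    have : φ =ᶠ[𝓝 x] fun _ => 0 := by
      filter_upwards [hS.mem_nhds hx, hK.isClosed.isOpen_compl.mem_nhds hxK] with y hy hyK
        using hφ0 y hy hyK
    simp [this.fderiv_eq]
  let w (i : Fin 2) (x : E2) : ℝ := u x * fderiv ℝ φ x (EuclideanSpace.single i 1) -
    φ x * fderiv ℝ u x (EuclideanSpace.single i 1)
  have hw (i : Fin 2) := setIntegral_fderiv_eq_zero hS hK hKS (w := w i)
    (((hu.of_le (by norm_num)).mul (hd hφ _)).sub ((hφ.of_le (by norm_num)).mul (hd hu _)))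
    (fun x hx hxK => by simp [w, hφ0 x hx hxK, hφ0' _ x hx hxK]) (EuclideanSpace.single i 1)
  have hsum : Set.EqOn (fun x => u x * lap φ x - φ x * lap u x)
      (fun x => ∑ i, fderiv ℝ (w i) x (EuclideanSpace.single i 1)) S := fun x hx => by
    have hux := hu.contDiffAt (hS.mem_nhds hx)
    have hφx := hφ.contDiffAt (hS.mem_nhds hx)
    simp only [lap, Finset.mul_sum]
    rw [← Finset.sum_sub_distrib]
    refine Finset.sum_congr rfl fun i _ => ?_
    have h1 := (hux.differentiableAt (by norm_num)).hasFDerivAt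
    have h2 := (hφx.differentiableAt (by norm_num)).hasFDerivAt
    have h3 := (differentiableAt_fderiv_apply hux (EuclideanSpace.single i 1)).hasFDerivAt
    have h4 := (differentiableAt_fderiv_apply hφx (EuclideanSpace.single i 1)).hasFDerivAt
    have h5 : HasFDerivAt (w i) _ x := (h1.mul h4).sub (h2.mul h3)
    rw [h5.fderiv]
    simp
    ring
  rw [setIntegral_congr_fun hS.measurableSet hsum, integral_finsetSum _ fun i _ => (hw i).1]
  exact Finset.sum_eq_zero fun i _ => (hw i).2

lemma one_le_of_logCutoffLap_ne_zero {κ : ℝ} {p x : E2} (h : logCutoffLap κ p x ≠ 0) :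
    1 ≤ κ * Real.log ‖x - p‖ := by
  by_contra! hlt
  exact h (by rw [logCutoffLap, deriv_deriv_step_eq_zero (.inl hlt)]; simp)

lemma one_le_of_logCutoff_ne_zero {κ : ℝ} {p x : E2} (h : logCutoff κ p x ≠ 0) :
    1 ≤ κ * Real.log ‖x - p‖ := by
  by_contra! hlt
  exact h (step_eq_zero hlt.le)

lemma le_exp_neg_of_one_le {r : ℝ} (hr : 0 ≤ r) (n : ℕ)
    (h : 1 ≤ -1 / ((n : ℝ) + 1) * Real.log r) : 0 < r ∧ r ≤ Real.exp (-((n : ℝ) + 1)) := by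
  have hr : 0 < r := hr.lt_of_ne (by rintro rfl; norm_num at h)
  have hn : (0 : ℝ) < n + 1 := by positivity
  refine ⟨hr, (Real.log_le_iff_le_exp hr).1 ?_⟩
  rw [div_mul_eq_mul_div, le_div_iff₀ hn] at h
  linarith

lemma exp_le_of_one_le {r : ℝ} (hr : 0 ≤ r) (n : ℕ)
    (h : 1 ≤ 1 / ((n : ℝ) + 1) * Real.log r) : Real.exp ((n : ℝ) + 1) ≤ r := by
  have hr : 0 < r := hr.lt_of_ne (by rintro rfl; norm_num at h)
  have hn : (0 : ℝ) < n + 1 := by positivity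
  refine (Real.le_log_iff_exp_le hr).1 ?_
  rw [div_mul_eq_mul_div, le_div_iff₀ hn] at h
  linarith

lemma logCutoff_eq_one_near (n : ℕ) {p x : E2} (hx : x ≠ p)
    (h : ‖x - p‖ ≤ Real.exp (-(2 * ((n : ℝ) + 1)))) :
    logCutoff (-1 / ((n : ℝ) + 1)) p x = 1 := by
  have hn : (0 : ℝ) < n + 1 := by positivity
  have := (Real.log_le_iff_le_exp (norm_pos_iff.2 (sub_ne_zero.2 hx))).2 h
  refine step_eq_one ?_
  rw [div_mul_eq_mul_div, le_div_iff₀ hn]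
  linarith

lemma logCutoff_eq_one_far (n : ℕ) {p x : E2} (h : Real.exp (2 * ((n : ℝ) + 1)) ≤ ‖x - p‖) :
    logCutoff (1 / ((n : ℝ) + 1)) p x = 1 := by
  have hn : (0 : ℝ) < n + 1 := by positivity
  have := (Real.le_log_iff_exp_le ((Real.exp_pos _).trans_le h)).2 h
  refine step_eq_one ?_
  rw [div_mul_eq_mul_div, le_div_iff₀ hn]
  linarith

lemma tendsto_div_nat_add_one (τ : ℝ) :
    Tendsto (fun n : ℕ => τ / ((n : ℝ) + 1)) atTop (𝓝 0) :=
  tendsto_const_nhds.div_atTop (tendsto_natCast_atTop_atTop.atTop_add tendsto_const_nhds)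

lemma logCutoff_eventually_eq_zero (τ : ℝ) (p x : E2) :
    ∀ᶠ n : ℕ in atTop, logCutoff (τ / ((n : ℝ) + 1)) p x = 0 := by
  have h := (tendsto_div_nat_add_one τ).mul_const (Real.log ‖x - p‖)
  rw [zero_mul] at h
  filter_upwards [h.eventually (gt_mem_nhds one_pos)] with n hn using step_eq_zero hn.le

/-- A function comparable to `a log|x - p|` at the singular end contributes `-2πa sign τ`
when paired with the Laplacian of the logarithmic cutoffs of scale `τ / (n + 1)`. -/
lemma tendsto_integral_mul_logCutoffLap {u : E2 → ℝ} (hu : AEStronglyMeasurable u volume)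
    (p : E2) {τ : ℝ} (hτ : τ ≠ 0) {a M : ℝ}
    (h : ∀ᶠ n : ℕ in atTop, ∀ x, logCutoffLap (τ / ((n : ℝ) + 1)) p x ≠ 0 →
      |u x - a * Real.log ‖x - p‖| ≤ M) :
    (∀ᶠ n : ℕ in atTop, Integrable fun x => u x * logCutoffLap (τ / ((n : ℝ) + 1)) p x) ∧
    Tendsto (fun n : ℕ => ∫ x, u x * logCutoffLap (τ / ((n : ℝ) + 1)) p x) atTop
      (𝓝 (-(2 * π * a * SignType.sign τ))) := by
  set κ : ℕ → ℝ := fun n => τ / ((n : ℝ) + 1) with hκdef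
  have hpos (n : ℕ) : (0 : ℝ) < n + 1 := by positivity
  have hκ (n : ℕ) : κ n ≠ 0 := div_ne_zero hτ (hpos n).ne'
  have hsign (n : ℕ) : SignType.sign (κ n) = SignType.sign τ := by
    simp only [hκdef, div_eq_mul_inv, sign_mul, sign_pos (inv_pos.2 (hpos n)), mul_one]
  let E (n : ℕ) (x : E2) : ℝ := logCutoffLap (κ n) p x
  let g (n : ℕ) (x : E2) : ℝ := (u x - a * Real.log ‖x - p‖) * E n x
  have hE (n : ℕ) : Integrable (E n) := integrable_logCutoffLap (hκ n) p
  have hlogE (n : ℕ) : Integrable fun x => Real.log ‖x - p‖ * E n x :=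
    integrable_log_mul_logCutoffLap (hκ n) p
  have hlog : AEStronglyMeasurable (fun x : E2 => a * Real.log ‖x - p‖) volume := by
    refine Measurable.aestronglyMeasurable ?_
    fun_prop
  have hgle : ∀ᶠ n in atTop, ∀ x, ‖g n x‖ ≤ M * |E n x| := by
    filter_upwards [h] with n hn x
    by_cases hx : E n x = 0
    · simp [g, hx]
    · rw [Real.norm_eq_abs, abs_mul]
      exact mul_le_mul_of_nonneg_right (hn x hx) (abs_nonneg _)
  have hg : ∀ᶠ n in atTop, Integrable (g n) := by
    filter_upwards [hgle] with n hn
    exact ((hE n).abs.const_mul M).mono' ((hu.sub hlog).mul (hE n).1) (.of_forall hn)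
  have hsplit (n : ℕ) (x : E2) :
      u x * E n x = a * (Real.log ‖x - p‖ * E n x) + g n x := by
    simp only [g]; ring
  refine ⟨?_, ?_⟩
  · filter_upwards [hg] with n hn
    exact (((hlogE n).const_mul a).add hn).congr (.of_forall fun x => (hsplit n x).symm)
  · have hg0 : Tendsto (fun n => ∫ x, g n x) atTop (𝓝 0) := by
      have hb : Tendsto (fun n => M * (|κ n| * (2 * π * ∫ s, |deriv (deriv step) s|)))
          atTop (𝓝 0) := by
        simpa using ((tendsto_div_nat_add_one τ).abs.mul_const
          (2 * π * ∫ s, |deriv (deriv step) s|)).const_mul M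
      refine squeeze_zero_norm' ?_ hb
      filter_upwards [hgle] with n hn
      rw [← integral_abs_logCutoffLap (hκ n) p, ← integral_const_mul]
      exact norm_integral_le_of_norm_le ((hE n).abs.const_mul M) (.of_forall hn)
    have hlim := hg0.const_add (a * -(2 * π * SignType.sign τ))
    rw [show -(2 * π * a * SignType.sign τ) = a * -(2 * π * SignType.sign τ) + 0 by ring]
    refine hlim.congr' ?_
    filter_upwards [hg] with n hn
    have hI := integral_log_mul_logCutoffLap (hκ n) p
    rw [hsign] at hI
    rw [← hI, ← integral_const_mul, ← integral_add ((hlogE n).const_mul a) hn]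
    exact integral_congr_ae (.of_forall fun x => (hsplit n x).symm)

lemma measurable_logCutoff (κ : ℝ) (p : E2) : Measurable (logCutoff κ p) := by
  have : Measurable step := (contDiff_step (n := 0)).continuous.measurable
  unfold logCutoff
  fun_prop

/-- The cutoff vanishing near `p₁`, `p₂` and `∞`. -/
def excision (p₁ p₂ : E2) (n : ℕ) (x : E2) : ℝ :=
  1 - logCutoff (-1 / ((n : ℝ) + 1)) p₁ x - logCutoff (-1 / ((n : ℝ) + 1)) p₂ x -
    logCutoff (1 / ((n : ℝ) + 1)) 0 x

lemma measurable_excision (p₁ p₂ : E2) (n : ℕ) : Measurable (excision p₁ p₂ n) :=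
  ((measurable_const.sub (measurable_logCutoff _ _)).sub (measurable_logCutoff _ _)).sub
    (measurable_logCutoff _ _)

lemma abs_excision_le (p₁ p₂ : E2) (n : ℕ) (x : E2) : |excision p₁ p₂ n x| ≤ 4 := by
  have h (κ : ℝ) (p : E2) := abs_le.1 (abs_step_le_one (κ * Real.log ‖x - p‖))
  have h1 := h (-1 / ((n : ℝ) + 1)) p₁
  have h2 := h (-1 / ((n : ℝ) + 1)) p₂
  have h3 := h (1 / ((n : ℝ) + 1)) 0
  rw [abs_le]
  simp only [excision, logCutoff]
  constructor <;> linarith [h1.1, h1.2, h2.1, h2.2, h3.1, h3.2]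

lemma tendsto_excision (p₁ p₂ x : E2) :
    Tendsto (fun n => excision p₁ p₂ n x) atTop (𝓝 1) := by
  refine tendsto_const_nhds.congr' ?_
  filter_upwards [logCutoff_eventually_eq_zero (-1) p₁ x,
    logCutoff_eventually_eq_zero (-1) p₂ x, logCutoff_eventually_eq_zero 1 0 x] with n h1 h2 h3
  rw [excision, h1, h2, h3]
  norm_num

lemma contDiffAt_excision (p₁ p₂ : E2) (n : ℕ) {x : E2} (h1 : x ≠ p₁) (h2 : x ≠ p₂) :
    ContDiffAt ℝ 2 (excision p₁ p₂ n) x :=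
  ((contDiffAt_const.sub (contDiffAt_logCutoff h1)).sub (contDiffAt_logCutoff h2)).sub
    (contDiff_logCutoff (by positivity) 0).contDiffAt

lemma lap_excision (p₁ p₂ : E2) (n : ℕ) {x : E2} (h1 : x ≠ p₁) (h2 : x ≠ p₂) :
    lap (excision p₁ p₂ n) x = -logCutoffLap (-1 / ((n : ℝ) + 1)) p₁ x -
      logCutoffLap (-1 / ((n : ℝ) + 1)) p₂ x - logCutoffLap (1 / ((n : ℝ) + 1)) 0 x := by
  have hn : 0 < 1 / ((n : ℝ) + 1) := by positivity
  have c0 : ContDiffAt ℝ 2 (fun _ : E2 => (1 : ℝ)) x := contDiffAt_const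
  have c1 := contDiffAt_logCutoff (κ := -1 / ((n : ℝ) + 1)) h1
  have c2 := contDiffAt_logCutoff (κ := -1 / ((n : ℝ) + 1)) h2
  have c3 := (contDiff_logCutoff hn 0).contDiffAt (x := x)
  unfold excision
  rw [lap_sub ((c0.sub c1).sub c2) c3, lap_sub (c0.sub c1) c2, lap_sub c0 c1, lap_const,
    lap_logCutoff h1, lap_logCutoff h2, lap_logCutoff_of_pos hn, zero_sub]

/-- For large `n` the excision vanishes outside a compact subset of `{p₁, p₂}ᶜ`. -/
lemma excision_eventually_support {p₁ p₂ : E2} (hp : p₁ ≠ p₂) :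
    ∀ᶠ n : ℕ in atTop, ∃ K : Set E2, IsCompact K ∧ K ⊆ {p₁, p₂}ᶜ ∧
      ∀ x ∈ ({p₁, p₂}ᶜ : Set E2), x ∉ K → excision p₁ p₂ n x = 0 := by
  have htop : Tendsto (fun n : ℕ => (n : ℝ) + 1) atTop atTop :=
    tendsto_natCast_atTop_atTop.atTop_add tendsto_const_nhds
  have hq := Real.tendsto_exp_neg_atTop_nhds_zero.comp htop
  have hQ := Real.tendsto_exp_atTop.comp htop
  have hd : 0 < ‖p₁ - p₂‖ / 2 := half_pos (norm_pos_iff.2 (sub_ne_zero.2 hp))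
  filter_upwards [hq.eventually (gt_mem_nhds hd), hQ.eventually_gt_atTop (‖p₁‖ + 1),
    hQ.eventually_gt_atTop (‖p₂‖ + 1)] with n hdn hQ1 hQ2
  simp only [Function.comp_apply] at hdn hQ1 hQ2
  have hn : (0 : ℝ) < n + 1 := by positivity
  have hq1 : Real.exp (-((n : ℝ) + 1)) ≤ 1 := Real.exp_le_one_iff.2 (by linarith)
  have hqq : Real.exp (-(2 * ((n : ℝ) + 1))) ≤ Real.exp (-((n : ℝ) + 1)) :=
    Real.exp_le_exp.2 (by linarith)
  have hQQ : Real.exp ((n : ℝ) + 1) ≤ Real.exp (2 * ((n : ℝ) + 1)) :=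
    Real.exp_le_exp.2 (by linarith)
  have near {p x : E2} (h : Real.exp (-((n : ℝ) + 1)) < ‖x - p‖) :
      logCutoff (-1 / ((n : ℝ) + 1)) p x = 0 := by
    by_contra hne
    exact absurd (le_exp_neg_of_one_le (norm_nonneg _) n (one_le_of_logCutoff_ne_zero hne)).2
      (not_le.2 h)
  have far {x : E2} (h : ‖x‖ < Real.exp ((n : ℝ) + 1)) :
      logCutoff (1 / ((n : ℝ) + 1)) 0 x = 0 := by
    by_contra hne
    have := exp_le_of_one_le (norm_nonneg _) n (one_le_of_logCutoff_ne_zero hne)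
    rw [sub_zero] at this
    exact absurd this (not_le.2 h)
  refine ⟨closedBall 0 (Real.exp (2 * ((n : ℝ) + 1))) \
    (ball p₁ (Real.exp (-(2 * ((n : ℝ) + 1)))) ∪ ball p₂ (Real.exp (-(2 * ((n : ℝ) + 1))))),
    (isCompact_closedBall _ _).diff (isOpen_ball.union isOpen_ball), ?_, ?_⟩
  · rintro x ⟨-, hx⟩ (rfl | rfl)
    · exact hx (.inl (mem_ball_self (Real.exp_pos _)))
    · exact hx (.inr (mem_ball_self (Real.exp_pos _)))
  · intro x hxS hxK
    simp only [Set.mem_compl_iff, Set.mem_insert_iff, Set.mem_singleton_iff, not_or] at hxS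
    have t1 : ‖x‖ ≤ ‖x - p₁‖ + ‖p₁‖ := by simpa using norm_add_le (x - p₁) p₁
    have t2 : ‖x‖ ≤ ‖x - p₂‖ + ‖p₂‖ := by simpa using norm_add_le (x - p₂) p₂
    have t3 : ‖p₁ - p₂‖ ≤ ‖x - p₁‖ + ‖x - p₂‖ := by
      simpa [norm_sub_rev] using norm_sub_le_norm_sub_add_norm_sub p₁ x p₂
    unfold excision
    by_cases b1 : ‖x - p₁‖ < Real.exp (-(2 * ((n : ℝ) + 1)))
    · rw [logCutoff_eq_one_near n hxS.1 b1.le, near (by linarith), far (by linarith)]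
      ring
    by_cases b2 : ‖x - p₂‖ < Real.exp (-(2 * ((n : ℝ) + 1)))
    · rw [logCutoff_eq_one_near n hxS.2 b2.le, near (by linarith), far (by linarith)]
      ring
    have b3 : Real.exp (2 * ((n : ℝ) + 1)) < ‖x‖ := by
      by_contra! hle
      refine hxK ⟨by simpa using hle, ?_⟩
      rintro (h | h)
      · exact b1 (by simpa [dist_eq_norm] using h)
      · exact b2 (by simpa [dist_eq_norm] using h)
    rw [near (p := p₁) (by linarith), near (p := p₂) (by linarith),
      logCutoff_eq_one_far n (by simpa using b3.le)]
    ring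

/-- The contribution of a logarithmic singularity at a finite point. -/
lemma tendsto_integral_mul_logCutoffLap_near {u : E2 → ℝ} (hu : AEStronglyMeasurable u volume)
    {p : E2} {a : ℝ} (h : ∃ ε > (0 : ℝ), ∃ M : ℝ, ∀ x : E2, x ≠ p → dist x p < ε →
      |u x - a * Real.log ‖x - p‖| ≤ M) :
    (∀ᶠ n : ℕ in atTop, Integrable fun x => u x * logCutoffLap (-1 / ((n : ℝ) + 1)) p x) ∧
    Tendsto (fun n : ℕ => ∫ x, u x * logCutoffLap (-1 / ((n : ℝ) + 1)) p x) atTop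
      (𝓝 (2 * π * a)) := by
  obtain ⟨ε, hε, M, hM⟩ := h
  have htop : Tendsto (fun n : ℕ => (n : ℝ) + 1) atTop atTop :=
    tendsto_natCast_atTop_atTop.atTop_add tendsto_const_nhds
  have hq := Real.tendsto_exp_neg_atTop_nhds_zero.comp htop
  have key := tendsto_integral_mul_logCutoffLap hu p (τ := -1) (by norm_num) (a := a) (M := M) ?_
  · simpa [sign_neg (show (-1 : ℝ) < 0 by norm_num)] using key
  · filter_upwards [hq.eventually (gt_mem_nhds hε)] with n hn x hx
    obtain ⟨h0, h1⟩ :=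
      le_exp_neg_of_one_le (norm_nonneg _) n (one_le_of_logCutoffLap_ne_zero hx)
    refine hM x (sub_ne_zero.1 (norm_pos_iff.1 h0)) ?_
    rw [dist_eq_norm]
    exact h1.trans_lt hn

/-- The contribution of logarithmic growth at infinity. -/
lemma tendsto_integral_mul_logCutoffLap_far {u : E2 → ℝ} (hu : AEStronglyMeasurable u volume)
    {a R M : ℝ} (h : ∀ x : E2, R < ‖x‖ → |u x - a * Real.log ‖x‖| ≤ M) :
    (∀ᶠ n : ℕ in atTop, Integrable fun x => u x * logCutoffLap (1 / ((n : ℝ) + 1)) 0 x) ∧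
    Tendsto (fun n : ℕ => ∫ x, u x * logCutoffLap (1 / ((n : ℝ) + 1)) 0 x) atTop
      (𝓝 (-(2 * π * a))) := by
  have htop : Tendsto (fun n : ℕ => (n : ℝ) + 1) atTop atTop :=
    tendsto_natCast_atTop_atTop.atTop_add tendsto_const_nhds
  have key := tendsto_integral_mul_logCutoffLap hu 0 (τ := 1) (by norm_num) (a := a) (M := M) ?_
  · simpa using key
  · filter_upwards [(Real.tendsto_exp_atTop.comp htop).eventually_gt_atTop R] with n hn x hx
    have h1 := exp_le_of_one_le (norm_nonneg _) n (one_le_of_logCutoffLap_ne_zero hx)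
    rw [sub_zero] at h1 ⊢
    exact h x (hn.trans_le h1)

/-- For a finite-energy solution of `Δu + 2eᵘ = 4π(θ₁−1)δ_{p₁} + 4π(θ₂−1)δ_{p₂}` with the
asymptotic expansion `u(y) = −α log|y| + c + O(|y|^{−σ})`,
`∇u(y) = −α y/|y|² + O(|y|^{−σ−1})` at infinity, the total mass is
`(1/(2π)) ∫ eᵘ = θ₁ + θ₂ + α/2 − 2 = θ₁ + θ₂ + θ₃ − 1` with `θ₃ = α/2 − 1`. -/
theorem singular_liouville_mass_from_asymptotics
    (p₁ p₂ : E2) (hp : p₁ ≠ p₂) (θ₁ θ₂ : ℝ) (hθ₁ : 0 < θ₁) (hθ₂ : 0 < θ₂)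
    (u : E2 → ℝ)
    (hreg : ContDiffOn ℝ 2 u ({p₁, p₂}ᶜ))
    (hpde : ∀ x : E2, x ≠ p₁ → x ≠ p₂ → lap u x + 2 * exp (u x) = 0)
    (hsing1 : ∃ ε > (0:ℝ), ∃ M : ℝ, ∀ x : E2, x ≠ p₁ → dist x p₁ < ε →
      |u x - 2 * (θ₁ - 1) * Real.log ‖x - p₁‖| ≤ M)
    (hsing2 : ∃ ε > (0:ℝ), ∃ M : ℝ, ∀ x : E2, x ≠ p₂ → dist x p₂ < ε →
      |u x - 2 * (θ₂ - 1) * Real.log ‖x - p₂‖| ≤ M)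
    (hint : Integrable (fun x : E2 => exp (u x)))
    (α c σ C : ℝ) (hα : 2 < α) (hσ : 0 < σ) (hC : 0 < C)
    (hasymp : ∃ R : ℝ, 0 < R ∧ ∀ y : E2, R < ‖y‖ →
      |u y + α * Real.log ‖y‖ - c| ≤ C * ‖y‖ ^ (-σ) ∧
      ‖gradient u y + (α / ‖y‖ ^ 2) • y‖ ≤ C * ‖y‖ ^ (-σ - 1)) :
    (1 / (2 * π)) * (∫ x : E2, exp (u x)) = θ₁ + θ₂ + α / 2 - 2 := by
  set S : Set E2 := {p₁, p₂}ᶜ with hSdef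
  have hSopen : IsOpen S := (Set.toFinite {p₁, p₂}).isClosed.isOpen_compl
  have hSmem {x : E2} (hx : x ∈ S) : x ≠ p₁ ∧ x ≠ p₂ := by simpa [hSdef] using hx
  have hSae : ∀ᵐ x : E2, x ∈ S := by
    exact compl_mem_ae_iff.2 ((Set.toFinite {p₁, p₂}).measure_zero volume)
  have hrestrict : (volume : Measure E2).restrict S = volume :=
    Measure.restrict_eq_self_of_ae_mem hSae
  have hu : AEStronglyMeasurable u volume := by
    rw [← hrestrict]
    exact hreg.continuousOn.aestronglyMeasurable hSopen.measurableSet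
  obtain ⟨R, hR, hasymp⟩ := hasymp
  have hfar : ∀ x : E2, max R 1 < ‖x‖ → |u x - -α * Real.log ‖x‖| ≤ |c| + C := by
    intro x hx
    have hx1 : 1 ≤ ‖x‖ := (le_max_right R 1).trans hx.le
    have h1 := (hasymp x ((le_max_left R 1).trans_lt hx)).1
    have h2 : C * ‖x‖ ^ (-σ) ≤ C := mul_le_of_le_one_right hC.le
      (Real.rpow_le_one_of_one_le_of_nonpos hx1 (by linarith))
    calc |u x - -α * Real.log ‖x‖| = |c + (u x + α * Real.log ‖x‖ - c)| := by ring_nf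
      _ ≤ |c| + |u x + α * Real.log ‖x‖ - c| := abs_add_le _ _
      _ ≤ |c| + C := by linarith
  obtain ⟨i1, l1⟩ := tendsto_integral_mul_logCutoffLap_near hu hsing1
  obtain ⟨i2, l2⟩ := tendsto_integral_mul_logCutoffLap_near hu hsing2
  obtain ⟨i3, l3⟩ := tendsto_integral_mul_logCutoffLap_far hu hfar
  have hφint (n : ℕ) : Integrable fun x => excision p₁ p₂ n x * exp (u x) :=
    hint.bdd_mul (measurable_excision p₁ p₂ n).aestronglyMeasurable
      (.of_forall fun x => abs_excision_le p₁ p₂ n x)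
  have l4 : Tendsto (fun n => ∫ x, excision p₁ p₂ n x * exp (u x)) atTop
      (𝓝 (∫ x, exp (u x))) := by
    refine tendsto_integral_of_dominated_convergence (fun x => 4 * exp (u x))
      (fun n => (hφint n).1) (hint.const_mul 4) (fun n => .of_forall fun x => ?_)
      (.of_forall fun x => ?_)
    · rw [norm_mul, Real.norm_eq_abs, Real.norm_eq_abs, abs_of_pos (exp_pos _)]
      exact mul_le_mul_of_nonneg_right (abs_excision_le p₁ p₂ n x) (exp_pos _).le
    · simpa using (tendsto_excision p₁ p₂ x).mul_const (exp (u x))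
  have hid : ∀ᶠ n : ℕ in atTop, 2 * (∫ x, excision p₁ p₂ n x * exp (u x)) =
      (∫ x, u x * logCutoffLap (-1 / ((n : ℝ) + 1)) p₁ x) +
      (∫ x, u x * logCutoffLap (-1 / ((n : ℝ) + 1)) p₂ x) +
      ∫ x, u x * logCutoffLap (1 / ((n : ℝ) + 1)) 0 x := by
    filter_upwards [i1, i2, i3, excision_eventually_support hp] with n j1 j2 j3 ⟨K, hK, hKS, hK0⟩
    have hgreen := setIntegral_green hSopen hK hKS hreg
      (fun x hx => (contDiffAt_excision p₁ p₂ n (hSmem hx).1 (hSmem hx).2).contDiffWithinAt) hK0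
    have hcongr : Set.EqOn
        (fun x => u x * lap (excision p₁ p₂ n) x - excision p₁ p₂ n x * lap u x)
        (fun x => 2 * (excision p₁ p₂ n x * exp (u x)) -
          (u x * logCutoffLap (-1 / ((n : ℝ) + 1)) p₁ x +
          u x * logCutoffLap (-1 / ((n : ℝ) + 1)) p₂ x +
          u x * logCutoffLap (1 / ((n : ℝ) + 1)) 0 x)) S := fun x hx => by
      obtain ⟨h1, h2⟩ := hSmem hx
      have h3 : lap u x = -(2 * exp (u x)) := by linarith [hpde x h1 h2]
      simp only [lap_excision p₁ p₂ n h1 h2, h3]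
      ring
    have hsum : Integrable fun x => u x * logCutoffLap (-1 / ((n : ℝ) + 1)) p₁ x +
        u x * logCutoffLap (-1 / ((n : ℝ) + 1)) p₂ x +
        u x * logCutoffLap (1 / ((n : ℝ) + 1)) 0 x := (j1.add j2).add j3
    rw [setIntegral_congr_fun hSopen.measurableSet hcongr, hrestrict,
      integral_sub ((hφint n).const_mul 2) hsum,
      integral_add (f := fun x => u x * logCutoffLap (-1 / ((n : ℝ) + 1)) p₁ x +
        u x * logCutoffLap (-1 / ((n : ℝ) + 1)) p₂ x) (j1.add j2) j3, integral_add j1 j2, integral_const_mul] at hgreen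
    linarith
  have hlim := tendsto_nhds_unique ((l4.const_mul 2).congr' hid) ((l1.add l2).add l3)
  have hmass : ∫ x : E2, exp (u x) = 2 * π * (θ₁ + θ₂ + α / 2 - 2) := by linarith
  rw [hmass]
  field_simp
end
end
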